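/- Let n ≥ 2, let ν be a finite Borel measure on ℝ^n, and let Γ ⊂ ℝ^n be a rectifiable curve. Suppose E ⊂ Γ is a Borel set and there exist constants c_E > 0 and r₀ > 0 such that ν(B(x,r)) ≥ c_E · r for all x ∈ E and all 0 < r ≤ r₀. Then there is a constant C depending only on n and c_E such that ∫_E J̃₂(ν,r₀,x) dν(x) ≤ C (H¹(Γ) + ν(ℝ^n \ Γ)). -/

import Mathlib

open MeasureTheory Metric Set Filter
open scoped ENNReal NNReal Topology

noncomputable section

/-- The closed dyadic cube in `ℝⁿ` of generation `k` (side length `2^(-k)`) with corner `z`. -/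
def dyadicCube (n : ℕ) (k : ℤ) (z : Fin n → ℤ) : Set (EuclideanSpace ℝ (Fin n)) :=
  {x | ∀ i, (z i : ℝ) * (2 : ℝ) ^ (-k) ≤ x i ∧ x i ≤ ((z i : ℝ) + 1) * (2 : ℝ) ^ (-k)}

/-- The concentric dilate `λQ` of the dyadic cube `Q` of generation `k` with corner `z`. -/
def dilatedCube (n : ℕ) (lam : ℝ) (k : ℤ) (z : Fin n → ℤ) : Set (EuclideanSpace ℝ (Fin n)) :=
  {x | ∀ i, |x i - ((z i : ℝ) + 1 / 2) * (2 : ℝ) ^ (-k)| ≤ lam * (2 : ℝ) ^ (-k) / 2}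

/-- The axis-parallel cube with center `c` and side length `s`. -/
def axisCube {n : ℕ} (c : EuclideanSpace ℝ (Fin n)) (s : ℝ) : Set (EuclideanSpace ℝ (Fin n)) :=
  {x | ∀ i, |x i - c i| ≤ s / 2}

/-- `L` is an (affine) line in `ℝⁿ`. -/
def IsLine {n : ℕ} (L : Set (EuclideanSpace ℝ (Fin n))) : Prop :=
  ∃ p v : EuclideanSpace ℝ (Fin n), v ≠ 0 ∧ L = {x | ∃ t : ℝ, x = p + t • v}

/-- `β₂(μ,Q)²`, the square of the `L²` beta number of `μ` on `Q`:
`inf_ℓ ∫_Q (dist(x,ℓ)/diam Q)² dμ(x)/μ(Q)`. When `μ Q = 0` this equals `0`,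
since `0/0 = 0` in `ℝ≥0∞`. -/
def beta2Sq {n : ℕ} (μ : Measure (EuclideanSpace ℝ (Fin n)))
    (Q : Set (EuclideanSpace ℝ (Fin n))) : ℝ≥0∞ :=
  ⨅ (L : Set (EuclideanSpace ℝ (Fin n))) (_ : IsLine L),
    (∫⁻ x in Q, ENNReal.ofReal ((Metric.infDist x L / Metric.diam Q) ^ 2) ∂μ) / μ Q

/-- The beta number `β_E(Q) = inf_ℓ sup_{x ∈ E ∩ Q} dist(x,ℓ)/diam Q` of a set `E`;
it is `0` when `E ∩ Q = ∅`. -/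
def betaSet {n : ℕ} (E Q : Set (EuclideanSpace ℝ (Fin n))) : ℝ≥0∞ :=
  ⨅ (L : Set (EuclideanSpace ℝ (Fin n))) (_ : IsLine L),
    ⨆ x ∈ E ∩ Q, ENNReal.ofReal (Metric.infDist x L / Metric.diam Q)

-- The ordinary `L²` Jones function at scale `r`:
-- `J₂(μ,r,x) = Σ_Q β₂²(μ,3Q) χ_Q(x)` over dyadic cubes `Q` of side length at most `r`.
open Classical in
def jones2 {n : ℕ} (μ : Measure (EuclideanSpace ℝ (Fin n))) (r : ℝ)
    (x : EuclideanSpace ℝ (Fin n)) : ℝ≥0∞ :=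
  ∑' (k : ℤ) (z : Fin n → ℤ),
    if (2 : ℝ) ^ (-k) ≤ r ∧ x ∈ dyadicCube n k z then beta2Sq μ (dilatedCube n 3 k z) else 0

-- The density-normalized `L²` Jones function at scale `r`:
-- `J̃₂(μ,r,x) = Σ_Q β₂²(μ,3Q) (diam Q / μ(Q)) χ_Q(x)` over dyadic cubes `Q` of side length
-- at most `r`, with the convention `0/0 = 0` (the term vanishes when `μ Q = 0`).
open Classical in
def jones2Tilde {n : ℕ} (μ : Measure (EuclideanSpace ℝ (Fin n))) (r : ℝ)
    (x : EuclideanSpace ℝ (Fin n)) : ℝ≥0∞ :=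
  ∑' (k : ℤ) (z : Fin n → ℤ),
    if (2 : ℝ) ^ (-k) ≤ r ∧ x ∈ dyadicCube n k z then
      (if μ (dyadicCube n k z) = 0 then 0
       else beta2Sq μ (dilatedCube n 3 k z) * ENNReal.ofReal (Metric.diam (dyadicCube n k z))
              / μ (dyadicCube n k z))
    else 0

/-- A measure `μ` on `ℝⁿ` is `1`-rectifiable: countably many bounded Borel sets `Eᵢ ⊆ ℝ` and
Lipschitz maps `fᵢ : Eᵢ → ℝⁿ` whose images carry the full mass of `μ`. -/
def Is1Rectifiable {n : ℕ} (μ : Measure (EuclideanSpace ℝ (Fin n))) : Prop :=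
  ∃ (E : ℕ → Set ℝ) (f : ℕ → ℝ → EuclideanSpace ℝ (Fin n)),
    (∀ i, Bornology.IsBounded (E i) ∧ MeasurableSet (E i) ∧
      ∃ K : ℝ≥0, LipschitzOnWith K (f i) (E i)) ∧
    μ (Set.univ \ ⋃ i, f i '' E i) = 0

/-- A measure `μ` on `ℝⁿ` is `m`-rectifiable: countably many bounded Borel sets `Eᵢ ⊆ ℝᵐ` and
Lipschitz maps `fᵢ : Eᵢ → ℝⁿ` whose images carry the full mass of `μ`. -/
def IsMRectifiable (m : ℕ) {n : ℕ} (μ : Measure (EuclideanSpace ℝ (Fin n))) : Prop :=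
  ∃ (E : ℕ → Set (EuclideanSpace ℝ (Fin m)))
    (f : ℕ → EuclideanSpace ℝ (Fin m) → EuclideanSpace ℝ (Fin n)),
    (∀ i, Bornology.IsBounded (E i) ∧ MeasurableSet (E i) ∧
      ∃ K : ℝ≥0, LipschitzOnWith K (f i) (E i)) ∧
    μ (Set.univ \ ⋃ i, f i '' E i) = 0

/-- A rectifiable curve in `ℝⁿ`: the image of a Lipschitz map on a compact interval. -/
def IsRectifiableCurve {n : ℕ} (Γ : Set (EuclideanSpace ℝ (Fin n))) : Prop :=
  ∃ (f : ℝ → EuclideanSpace ℝ (Fin n)) (a b : ℝ) (K : ℝ≥0),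
    LipschitzOnWith K f (Set.Icc a b) ∧ Γ = f '' Set.Icc a b

/-- The lower Hausdorff `1`-density `Θ¹_*(μ,x) = liminf_{r→0⁺} μ(B(x,r))/(2r)`. -/
def lowerDensity1 {n : ℕ} (μ : Measure (EuclideanSpace ℝ (Fin n)))
    (x : EuclideanSpace ℝ (Fin n)) : ℝ≥0∞ :=
  Filter.liminf (fun r : ℝ => μ (Metric.closedBall x r) / ENNReal.ofReal (2 * r)) (𝓝[>] 0)

/-- The upper Hausdorff `1`-density `Θ*¹(μ,x) = limsup_{r→0⁺} μ(B(x,r))/(2r)`. -/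
def upperDensity1 {n : ℕ} (μ : Measure (EuclideanSpace ℝ (Fin n)))
    (x : EuclideanSpace ℝ (Fin n)) : ℝ≥0∞ :=
  Filter.limsup (fun r : ℝ => μ (Metric.closedBall x r) / ENNReal.ofReal (2 * r)) (𝓝[>] 0)

/-- The lower Hausdorff `m`-density `Θᵐ_*(μ,x) = liminf_{r→0⁺} μ(B(x,r))/(ω_m rᵐ)`, where
`ω_m` is the Lebesgue volume of the unit ball in `ℝᵐ`. -/
def lowerDensity (m : ℕ) {n : ℕ} (μ : Measure (EuclideanSpace ℝ (Fin n)))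
    (x : EuclideanSpace ℝ (Fin n)) : ℝ≥0∞ :=
  Filter.liminf
    (fun r : ℝ => μ (Metric.closedBall x r) /
      (MeasureTheory.volume (Metric.ball (0 : EuclideanSpace ℝ (Fin m)) 1) *
        ENNReal.ofReal (r ^ m)))
    (𝓝[>] 0)

/-- The `δ`-packing prenumber `P^s_δ(A)`: the supremum of `Σᵢ (2rᵢ)^s` over all countable
packings of `A` by disjoint closed balls centered in `A` of diameter at most `δ`. -/
def packingPreAt {X : Type*} [PseudoMetricSpace X] (s δ : ℝ) (A : Set X) : ℝ≥0∞ :=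
  ⨆ (S : Set (X × ℝ)) (_ : S.Countable)
    (_ : ∀ p ∈ S, p.1 ∈ A ∧ 0 < p.2 ∧ 2 * p.2 ≤ δ)
    (_ : S.Pairwise fun p q => Disjoint (Metric.closedBall p.1 p.2) (Metric.closedBall q.1 q.2)),
    ∑' p : S, ENNReal.ofReal ((2 * p.1.2) ^ s)

/-- The `s`-dimensional packing premeasure `P^s(A) = lim_{δ→0⁺} P^s_δ(A)`; since `P^s_δ(A)`
is nonincreasing in `δ`, the limit equals the infimum over `δ > 0`. -/
def packingPre {X : Type*} [PseudoMetricSpace X] (s : ℝ) (A : Set X) : ℝ≥0∞ :=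
  ⨅ (δ : ℝ) (_ : 0 < δ), packingPreAt s δ A

/-- The `s`-dimensional packing measure
`𝒫^s(A) = inf { Σᵢ P^s(Aᵢ) : A = ⋃ᵢ Aᵢ }`. -/
def packingMeasure {X : Type*} [PseudoMetricSpace X] (s : ℝ) (A : Set X) : ℝ≥0∞ :=
  ⨅ (F : ℕ → Set X) (_ : A = ⋃ i, F i), ∑' i, packingPre s (F i)

/-- The contraction of the direction `e` by the factor `η`. -/
def squeeze {E : Type*} [NormedAddCommGroup E] [InnerProductSpace ℝ E] (e : E) (η : ℝ) :
    E →ₗ[ℝ] E :=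
  LinearMap.transvection (innerₛₗ ℝ e) ((η - 1) • e)

theorem squeeze_apply {E : Type*} [NormedAddCommGroup E] [InnerProductSpace ℝ E] (e : E) (η : ℝ)
    (x : E) : squeeze e η x = x + ((η - 1) * inner ℝ e x) • e := by
  simp [squeeze, LinearMap.transvection.apply, smul_smul, mul_comm]

theorem det_squeeze {E : Type*} [NormedAddCommGroup E] [InnerProductSpace ℝ E]
    [FiniteDimensional ℝ E] {e : E} (he : ‖e‖ = 1) (η : ℝ) :
    LinearMap.det (squeeze e η) = η := by
  simp [squeeze, LinearMap.transvection.det, he]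

theorem inner_squeeze {E : Type*} [NormedAddCommGroup E] [InnerProductSpace ℝ E] (e : E) (η : ℝ)
    (x y : E) : inner ℝ (squeeze e η x) y = inner ℝ x (squeeze e η y) := by
  simp only [squeeze_apply, inner_add_left, inner_add_right, inner_smul_left, inner_smul_right,
    real_inner_comm e x]
  simp
  ring

theorem norm_squeeze_sq {E : Type*} [NormedAddCommGroup E] [InnerProductSpace ℝ E] {e : E}
    (he : ‖e‖ = 1) (η : ℝ) (x : E) :
    ‖squeeze e η x‖ ^ 2 = ‖x‖ ^ 2 + (η ^ 2 - 1) * (inner ℝ e x) ^ 2 := by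
  rw [squeeze_apply, norm_add_sq_real, inner_smul_right, norm_smul, he, real_inner_comm,
    Real.norm_eq_abs, mul_one, sq_abs]
  ring

theorem norm_squeeze_le {E : Type*} [NormedAddCommGroup E] [InnerProductSpace ℝ E] {e : E}
    (he : ‖e‖ = 1) {η : ℝ} (h0 : 0 ≤ η) (h1 : η ≤ 1) (x : E) : ‖squeeze e η x‖ ≤ ‖x‖ := by
  have h := norm_squeeze_sq he η x
  have : η ^ 2 ≤ 1 := by nlinarith
  refine le_of_sq_le_sq ?_ (norm_nonneg x)
  nlinarith [sq_nonneg (inner ℝ e x)]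

theorem le_norm_squeeze {E : Type*} [NormedAddCommGroup E] [InnerProductSpace ℝ E] {e : E}
    (he : ‖e‖ = 1) {η : ℝ} (h0 : 0 ≤ η) (h1 : η ≤ 1) (x : E) : η * ‖x‖ ≤ ‖squeeze e η x‖ := by
  have h := norm_squeeze_sq he η x
  have h2 : η ^ 2 ≤ 1 := by nlinarith
  have h3 : (inner ℝ e x) ^ 2 ≤ ‖x‖ ^ 2 := by
    have := abs_real_inner_le_norm e x
    rw [he, one_mul] at this
    exact sq_le_sq' (abs_le.1 this).1 (abs_le.1 this).2
  refine le_of_sq_le_sq ?_ (norm_nonneg _)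
  nlinarith [mul_nonneg (sub_nonneg.2 h2) (sub_nonneg.2 h3)]

theorem exists_ball_le_abs_inner {E : Type*} [NormedAddCommGroup E] [InnerProductSpace ℝ E]
    (x v : E) {ρ : ℝ} (hρ : 0 < ρ) :
    ∃ y : E, ∀ z ∈ ball y (ρ / 4), ‖z - x‖ ≤ ρ ∧ ρ / 4 * ‖v‖ ≤ |inner ℝ z v| := by
  rcases eq_or_ne v 0 with rfl | hv
  · refine ⟨x, fun z hz => ⟨?_, by simp⟩⟩
    rw [mem_ball, dist_eq_norm] at hz
    linarith
  have hv' : 0 < ‖v‖ := norm_pos_iff.2 hv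
  obtain ⟨σ, hσ, hσx⟩ : ∃ σ : ℝ, |σ| = 1 ∧ 0 ≤ σ * inner ℝ x v := by
    rcases le_total 0 (inner ℝ x v) with h | h
    · exact ⟨1, by simp, by simpa using h⟩
    · exact ⟨-1, by simp, by linarith⟩
  refine ⟨x + (σ * (ρ / 2) / ‖v‖) • v, fun z hz => ?_⟩
  rw [mem_ball, dist_eq_norm] at hz
  set w := z - (x + (σ * (ρ / 2) / ‖v‖) • v) with hw
  have hz' : z = x + (σ * (ρ / 2) / ‖v‖) • v + w := by rw [hw]; abel
  constructor
  · have : z - x = (σ * (ρ / 2) / ‖v‖) • v + w := by rw [hz']; abel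
    rw [this]
    refine (norm_add_le _ _).trans ?_
    rw [norm_smul, Real.norm_eq_abs, abs_div, abs_mul, hσ, abs_of_pos hv',
      abs_of_pos (half_pos hρ), one_mul, div_mul_cancel₀ _ hv'.ne']
    linarith
  · have h1 : inner ℝ z v = inner ℝ x v + σ * (ρ / 2) * ‖v‖ + inner ℝ w v := by
      rw [hz', inner_add_left, inner_add_left, real_inner_smul_left, real_inner_self_eq_norm_sq]
      field_simp
    have h2 : |inner ℝ w v| ≤ ρ / 4 * ‖v‖ :=
      (abs_real_inner_le_norm w v).trans (by gcongr)
    have hσ2 : σ * σ = 1 := by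
      have := congrArg (· ^ 2) hσ
      simp only [sq_abs] at this
      nlinarith
    have h3 : σ * inner ℝ z v = σ * inner ℝ x v + ρ / 2 * ‖v‖ + σ * inner ℝ w v := by
      rw [h1]; linear_combination (ρ / 2 * ‖v‖) * hσ2
    have h4 : |σ * inner ℝ w v| = |inner ℝ w v| := by rw [abs_mul, hσ, one_mul]
    have h5 : |σ * inner ℝ z v| = |inner ℝ z v| := by rw [abs_mul, hσ, one_mul]
    rw [← h5]
    refine le_trans ?_ (le_abs_self _)
    rw [h3]
    linarith [(abs_le.1 (h4.le.trans h2)).1]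

/-- The pairs `(u, t)` for which the hyperplane `⟪u, x⟫ = t` strictly separates `p` from `p'` and
`q` from `q'`. -/
def separators {E : Type*} [NormedAddCommGroup E] [InnerProductSpace ℝ E] (p p' q q' : E) :
    Set (E × ℝ) :=
  {w | (inner ℝ w.1 p - w.2) * (inner ℝ w.1 p' - w.2) < 0 ∧
    (inner ℝ w.1 q - w.2) * (inner ℝ w.1 q' - w.2) < 0}

theorem isOpen_separators {E : Type*} [NormedAddCommGroup E] [InnerProductSpace ℝ E]
    (p p' q q' : E) : IsOpen (separators p p' q q') :=
  IsOpen.inter (isOpen_lt (f := fun w : E × ℝ => (inner ℝ w.1 p - w.2) * (inner ℝ w.1 p' - w.2))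
    (g := fun _ => 0) (by fun_prop) (by fun_prop))
    (isOpen_lt (f := fun w : E × ℝ => (inner ℝ w.1 q - w.2) * (inner ℝ w.1 q' - w.2))
    (g := fun _ => 0) (by fun_prop) (by fun_prop))

theorem ofReal_le_volume_separated {a b c d m : ℝ} (h1 : m ≤ c - a) (h2 : m ≤ b - c)
    (h3 : m ≤ |d - c|) :
    ENNReal.ofReal m ≤ volume {t : ℝ | (a - t) * (b - t) < 0 ∧ (c - t) * (d - t) < 0} := by
  rcases le_abs.1 h3 with h3 | h3
  · have : Ioo c (c + m) ⊆ {t : ℝ | (a - t) * (b - t) < 0 ∧ (c - t) * (d - t) < 0} := by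
      rintro t ⟨ht1, ht2⟩
      exact ⟨mul_neg_of_neg_of_pos (by linarith) (by linarith),
        mul_neg_of_neg_of_pos (by linarith) (by linarith)⟩
    refine le_trans ?_ (measure_mono this)
    simp
  · have : Ioo (c - m) c ⊆ {t : ℝ | (a - t) * (b - t) < 0 ∧ (c - t) * (d - t) < 0} := by
      rintro t ⟨ht1, ht2⟩
      exact ⟨mul_neg_of_neg_of_pos (by linarith) (by linarith),
        mul_neg_of_pos_of_neg (by linarith) (by linarith)⟩
    refine le_trans ?_ (measure_mono this)
    simp

/-- The measure on pairs `(u, t)`, with `u` in the unit ball and `t` real, parametrizing the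
hyperplanes `⟪u, x⟫ = t`. -/
def hyperplaneMeasure (n : ℕ) : Measure (EuclideanSpace ℝ (Fin n) × ℝ) :=
  (volume.restrict (ball (0 : EuclideanSpace ℝ (Fin n)) 1)).prod volume

/-- The squared distance of `q` from the line through `p` and `p'` is controlled by the measure of
the hyperplanes that separate `p` from `p'` and `q` from `q'` strictly. -/
theorem exists_ofReal_sq_le_hyperplaneMeasure_separators (n : ℕ) {M : ℝ} (hM : 1 ≤ M) :
    ∃ C : ℝ, 0 < C ∧ ∀ (p p' q q' : EuclideanSpace ℝ (Fin n)) (r : ℝ), 0 < r → ‖p' - p‖ = r →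
      ‖q' - q‖ = r → ‖q - p‖ ≤ M * r →
      ENNReal.ofReal (‖(q - p) - inner ℝ (r⁻¹ • (p' - p)) (q - p) • (r⁻¹ • (p' - p))‖ ^ 2) ≤
        ENNReal.ofReal (C * r) * hyperplaneMeasure n (separators p p' q q') := by
  set ρ : ℝ := 1 / (96 * M) with hρdef
  have hM0 : 0 < M := by linarith
  have hρ : 0 < ρ := by positivity
  have hρM : ρ * M = 1 / 96 := by rw [hρdef]; field_simp
  have hρ1 : ρ ≤ 1 / 96 := by nlinarith
  set κ : ℝ := ρ / 4 * (volume (ball (0 : EuclideanSpace ℝ (Fin n)) (ρ / 4))).toReal with hκdef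
  have hvol : volume (ball (0 : EuclideanSpace ℝ (Fin n)) (ρ / 4)) ≠ ⊤ := measure_ball_lt_top.ne
  have hκ : 0 < κ := mul_pos (by positivity)
    (ENNReal.toReal_pos (measure_ball_pos volume _ (by positivity)).ne' hvol)
  refine ⟨M ^ 2 / κ, by positivity, fun p p' q q' r hr hp hq hqp => ?_⟩
  obtain ⟨e, he_def⟩ : ∃ e, e = r⁻¹ • (p' - p) := ⟨_, rfl⟩
  rw [← he_def]
  have he : ‖e‖ = 1 := by
    rw [he_def, norm_smul, hp, norm_inv, Real.norm_of_nonneg hr.le, inv_mul_cancel₀ hr.ne']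
  have hpe : p' - p = r • e := by rw [he_def, smul_smul, mul_inv_cancel₀ hr.ne', one_smul]
  set a := inner ℝ e (q - p) with ha_def
  have ha : |a| ≤ M * r := by
    refine (abs_real_inner_le_norm _ _).trans ?_
    rwa [he, one_mul]
  set h := ‖(q - p) - a • e‖ with hh_def
  rcases eq_or_ne h 0 with h0 | h0
  · simp [h0]
  have hhpos : 0 < h := lt_of_le_of_ne (norm_nonneg _) (Ne.symm h0)
  obtain ⟨w, hw_def⟩ : ∃ w, w = h⁻¹ • ((q - p) - a • e) := ⟨_, rfl⟩
  have hw : ‖w‖ = 1 := by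
    rw [hw_def, norm_smul, ← hh_def, norm_inv, Real.norm_of_nonneg hhpos.le,
      inv_mul_cancel₀ h0]
  have hqpw : q - p = a • e + h • w := by
    rw [hw_def, smul_smul, mul_inv_cancel₀ h0, one_smul]; abel
  have hee : inner ℝ e e = (1 : ℝ) := by rw [real_inner_self_eq_norm_sq, he]; norm_num
  have hww : inner ℝ w w = (1 : ℝ) := by rw [real_inner_self_eq_norm_sq, hw]; norm_num
  have hew : inner ℝ e w = (0 : ℝ) := by
    rw [hw_def, inner_smul_right, inner_sub_right, inner_smul_right, hee, ← ha_def]; simp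
  have hwe : inner ℝ w e = (0 : ℝ) := by rw [real_inner_comm, hew]
  have hh : h ≤ M * r := by
    refine le_trans ?_ hqp
    have : ‖q - p‖ ^ 2 = a ^ 2 + h ^ 2 := by
      rw [hqpw, norm_add_sq_real, norm_smul, norm_smul, he, hw, inner_smul_left, inner_smul_right,
        hew]
      simp
    exact le_of_sq_le_sq (by nlinarith [sq_nonneg a]) (norm_nonneg _)
  set η := h / (M * r) with hη_def
  have hη : 0 < η := by positivity
  have hη1 : η ≤ 1 := by rw [hη_def, div_le_one (by positivity)]; exact hh
  have hhη : h = η * (M * r) := by rw [hη_def]; field_simp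
  have hTp : squeeze e η (p' - p) = (η * r) • e := by
    rw [squeeze_apply, hpe, inner_smul_right, hee, ← add_smul]; congr 1; ring
  have hTq : squeeze e η (q - p) = η • (a • e + (M * r) • w) := by
    have : inner ℝ e (q - p) = a := rfl
    rw [squeeze_apply, this, hqpw, hhη]; module
  set κ' := (r / 2 - a) / (M * r) with hκ'
  have hκ'1 : |κ'| ≤ 3 / 2 := by
    rw [hκ', abs_div, abs_of_pos (show 0 < M * r by positivity), div_le_iff₀ (by positivity)]
    have := abs_le.1 ha
    rw [abs_le]
    constructor <;> nlinarith
  set x₀ := (1 / 6 : ℝ) • (e + κ' • w) with hx₀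
  have hx₀n : ‖x₀‖ ≤ 1 / 2 := by
    rw [hx₀, norm_smul]
    have := norm_add_le e (κ' • w)
    rw [norm_smul, he, hw, Real.norm_eq_abs, mul_one] at this
    rw [Real.norm_of_nonneg (by norm_num)]
    linarith
  obtain ⟨y, hy⟩ := exists_ball_le_abs_inner x₀ (squeeze e η (q' - q)) hρ
  have hvnorm : η * r ≤ ‖squeeze e η (q' - q)‖ := by
    have := le_norm_squeeze he hη.le hη1 (q' - q)
    rwa [hq] at this
  set m := η * r * (ρ / 4) with hm_def
  have hm : 0 ≤ m := by positivity
  have key : ∀ u ∈ squeeze e η '' ball y (ρ / 4), u ∈ ball (0 : EuclideanSpace ℝ (Fin n)) 1 ∧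
      ENNReal.ofReal m ≤ volume (Prod.mk u ⁻¹' separators p p' q q') := by
    rintro _ ⟨z, hz, rfl⟩
    obtain ⟨hz1, hz2⟩ := hy z hz
    constructor
    · rw [mem_ball_zero_iff]
      refine (norm_squeeze_le he hη.le hη1 z).trans_lt ?_
      have := norm_le_norm_add_norm_sub' z x₀
      linarith
    · have hze : |inner ℝ (z - x₀) e| ≤ ρ := by
        refine (abs_real_inner_le_norm _ _).trans ?_
        rwa [he, mul_one]
      have hzw : |inner ℝ (z - x₀) w| ≤ ρ := by
        refine (abs_real_inner_le_norm _ _).trans ?_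
        rwa [hw, mul_one]
      have hA : inner ℝ (squeeze e η z) p' - inner ℝ (squeeze e η z) p
          = η * r * (1 / 6 + inner ℝ (z - x₀) e) := by
        rw [← inner_sub_right, inner_squeeze, hTp, inner_smul_right, inner_sub_left, hx₀,
          inner_smul_left, inner_add_left, inner_smul_left, hee, hwe]
        simp
      have hB : inner ℝ (squeeze e η z) q - inner ℝ (squeeze e η z) p
          = η * (r / 12 + (a * inner ℝ (z - x₀) e + M * r * inner ℝ (z - x₀) w)) := by
        have hMr : M * r * κ' = r / 2 - a := by rw [hκ']; field_simp
        rw [← inner_sub_right, inner_squeeze, hTq, inner_smul_right, inner_add_right,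
          inner_smul_right, inner_smul_right, inner_sub_left, inner_sub_left, hx₀,
          inner_smul_left, inner_smul_left, inner_add_left, inner_add_left, inner_smul_left,
          inner_smul_left, hee, hwe, hew, hww]
        simp only [conj_trivial]
        linear_combination (η / 6) * hMr
      have hD : m ≤ |inner ℝ (squeeze e η z) q' - inner ℝ (squeeze e η z) q| := by
        rw [← inner_sub_right, inner_squeeze]
        refine le_trans ?_ hz2
        rw [hm_def]
        calc η * r * (ρ / 4) = ρ / 4 * (η * r) := by ring
          _ ≤ _ := by gcongr
      have hpert : |a * inner ℝ (z - x₀) e + M * r * inner ℝ (z - x₀) w| ≤ r / 48 := by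
        refine (abs_add_le _ _).trans ?_
        rw [abs_mul, abs_mul, abs_of_pos (show 0 < M * r by positivity)]
        have h1 : |a| * |inner ℝ (z - x₀) e| ≤ M * r * ρ := by gcongr
        have h2 : M * r * |inner ℝ (z - x₀) w| ≤ M * r * ρ := by gcongr
        have h3 : M * r * ρ = r / 96 := by linear_combination r * hρM
        linarith
      have hηr : 0 < η * r := by positivity
      refine le_trans (ofReal_le_volume_separated (a := inner ℝ (squeeze e η z) p)
        (b := inner ℝ (squeeze e η z) p') ?_ ?_ hD) le_rfl
      · rw [hB, hm_def, mul_assoc]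
        gcongr
        have := (abs_le.1 hpert).1
        have : r * (ρ / 4) ≤ r * (1 / 96 / 4) := by gcongr
        linarith
      · have : inner ℝ (squeeze e η z) p' - inner ℝ (squeeze e η z) q
            = η * (r * (1 / 6 + inner ℝ (z - x₀) e) - (r / 12 +
              (a * inner ℝ (z - x₀) e + M * r * inner ℝ (z - x₀) w))) := by
          linear_combination hA - hB
        rw [this, hm_def, mul_assoc]
        gcongr
        have := (abs_le.1 hpert).2
        have : r * (-(1 / 96)) ≤ r * inner ℝ (z - x₀) e := by
          gcongr
          linarith [(abs_le.1 hze).1]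
        have : r * (ρ / 4) ≤ r * (1 / 96 / 4) := by gcongr
        linarith
  have hS : MeasurableSet (separators p p' q q') := (isOpen_separators p p' q q').measurableSet
  have hlow : ENNReal.ofReal (m * (η * (volume (ball (0 : EuclideanSpace ℝ (Fin n))
      (ρ / 4))).toReal)) ≤ hyperplaneMeasure n (separators p p' q q') := by
    rw [hyperplaneMeasure, Measure.prod_apply hS]
    calc ENNReal.ofReal (m * (η * (volume (ball (0 : EuclideanSpace ℝ (Fin n))
          (ρ / 4))).toReal))
        = ENNReal.ofReal m * volume (squeeze e η '' ball y (ρ / 4)) := by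
          rw [Measure.addHaar_image_linearMap, det_squeeze he, abs_of_pos hη,
            Measure.addHaar_ball_center volume y, ENNReal.ofReal_mul hm, ENNReal.ofReal_mul hη.le,
            ENNReal.ofReal_toReal hvol]
      _ = ∫⁻ _ in squeeze e η '' ball y (ρ / 4), ENNReal.ofReal m := by
          rw [setLIntegral_const]
      _ ≤ ∫⁻ u in squeeze e η '' ball y (ρ / 4),
            volume (Prod.mk u ⁻¹' separators p p' q q') :=
          setLIntegral_mono (measurable_measure_prodMk_left hS) fun u hu => (key u hu).2
      _ ≤ _ := lintegral_mono_set fun u hu => (key u hu).1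
  refine le_trans ?_ (mul_le_mul_right hlow _)
  rw [← ENNReal.ofReal_mul (by positivity)]
  apply ENNReal.ofReal_le_ofReal
  apply le_of_eq
  have hκη : m * (η * (volume (ball (0 : EuclideanSpace ℝ (Fin n)) (ρ / 4))).toReal)
      = η ^ 2 * r * κ := by
    rw [hm_def, hκdef]; ring
  rw [hκη, hhη]
  field_simp

/-- A Lipschitz function with constant one satisfies the Eilenberg inequality: the integral of the
cardinalities of its fibres in `Γ` is at most the length of `Γ`. -/
theorem lintegral_encard_fiber_le {n : ℕ} (Γ : Set (EuclideanSpace ℝ (Fin n)))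
    {g : EuclideanSpace ℝ (Fin n) → ℝ} (hg : LipschitzWith 1 g) :
    ∫⁻ t, ((Γ ∩ g ⁻¹' {t}).encard : ℝ≥0∞) ≤ μH[1] Γ := by
  classical
  set code : ℕ → EuclideanSpace ℝ (Fin n) → (Fin n → ℤ) := fun m x i => ⌊(2 : ℝ) ^ m * x i⌋
    with hcode
  have hmeas : ∀ m, Measurable (code m) := fun m =>
    measurable_pi_lambda _ fun i => Int.measurable_floor.comp (by fun_prop)
  set A : ℕ → (Fin n → ℤ) → Set ℝ := fun m z =>
    toMeasurable volume (g '' (Γ ∩ code m ⁻¹' {z})) with hA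
  set c : ℕ → ℝ → ℝ≥0∞ := fun m t => ∑' z, (A m z).indicator 1 t with hc
  have hAm : ∀ m z, Measurable ((A m z).indicator (1 : ℝ → ℝ≥0∞)) := fun m z =>
    measurable_one.indicator (measurableSet_toMeasurable _ _)
  have hcint : ∀ m, ∫⁻ t, c m t ≤ μH[1] Γ := by
    intro m
    rw [lintegral_tsum fun z => (hAm m z).aemeasurable]
    calc ∑' z, ∫⁻ t, (A m z).indicator 1 t
        ≤ ∑' z, (μH[1].restrict Γ) (code m ⁻¹' {z}) := by
          refine ENNReal.tsum_le_tsum fun z => ?_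
          rw [lintegral_indicator_one (measurableSet_toMeasurable _ _), measure_toMeasurable,
            Measure.restrict_apply ((hmeas m) (measurableSet_singleton z)), inter_comm,
            ← hausdorffMeasure_real]
          simpa [inter_comm] using hg.hausdorffMeasure_image_le zero_le_one (Γ ∩ code m ⁻¹' {z})
      _ = (μH[1].restrict Γ) (⋃ z, code m ⁻¹' {z}) := by
          rw [measure_iUnion (fun z z' hz => Disjoint.preimage _ (by simpa using hz))
            fun z => (hmeas m) (measurableSet_singleton z)]
      _ ≤ μH[1] Γ := by
          refine (measure_mono (subset_univ _)).trans ?_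
          rw [Measure.restrict_apply_univ]
  have hle : ∀ t, ((Γ ∩ g ⁻¹' {t}).encard : ℝ≥0∞) ≤ liminf (fun m => c m t) atTop := by
    intro t
    have hfin : ∀ s : Finset (EuclideanSpace ℝ (Fin n)), (s : Set _) ⊆ Γ ∩ g ⁻¹' {t} →
        (s.card : ℝ≥0∞) ≤ liminf (fun m => c m t) atTop := by
      intro s hs
      refine le_liminf_of_le (by isBoundedDefault) ?_
      have hinj : ∀ᶠ m in atTop, ∀ x ∈ s, ∀ y ∈ s, x ≠ y → code m x ≠ code m y := by
        refine (Filter.eventually_all_finset s).2 fun x _ =>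
          (Filter.eventually_all_finset s).2 fun y _ => ?_
        by_cases hxy : x = y
        · simp [hxy]
        obtain ⟨i, hi⟩ : ∃ i, x i ≠ y i := by
          by_contra! h
          exact hxy (PiLp.ext h)
        have hpos : 0 < |x i - y i| := abs_pos.2 (sub_ne_zero.2 hi)
        have := (tendsto_pow_atTop_atTop_of_one_lt (one_lt_two (α := ℝ))).eventually_ge_atTop
          (1 / |x i - y i|)
        filter_upwards [this] with m hm _ heq
        have h1 := Int.abs_sub_lt_one_of_floor_eq_floor (congrFun heq i)
        rw [← mul_sub, abs_mul, abs_of_pos (by positivity)] at h1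
        rw [div_le_iff₀ hpos] at hm
        linarith
      filter_upwards [hinj] with m hm
      calc (s.card : ℝ≥0∞) = ((s.image (code m)).card : ℝ≥0∞) := by
            rw [Finset.card_image_of_injOn fun x hx y hy h => by
              by_contra hne
              exact hm x hx y hy hne h]
        _ = ∑ z ∈ s.image (code m), (1 : ℝ≥0∞) := by simp
        _ ≤ ∑ z ∈ s.image (code m), (A m z).indicator 1 t := by
            refine Finset.sum_le_sum fun z hz => ?_
            obtain ⟨x, hx, rfl⟩ := Finset.mem_image.1 hz
            rw [indicator_of_mem]
            · rfl
            · exact subset_toMeasurable _ _ ⟨x, ⟨(hs hx).1, rfl⟩, (hs hx).2⟩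
        _ ≤ c m t := ENNReal.sum_le_tsum _
    by_cases hP : (Γ ∩ g ⁻¹' {t}).Finite
    · rw [hP.encard_eq_coe_toFinset_card]
      exact hfin _ (by simp)
    · rw [Set.encard_eq_top_iff.2 hP, ENat.toENNReal_top, top_le_iff]
      refine ENNReal.eq_top_of_forall_nnreal_le fun r => ?_
      obtain ⟨k, hk⟩ := exists_nat_ge r
      obtain ⟨s, hs, hcard⟩ := Set.Infinite.exists_subset_card_eq hP k
      refine le_trans ?_ (hfin s hs)
      rw [hcard]
      exact_mod_cast hk
  calc ∫⁻ t, ((Γ ∩ g ⁻¹' {t}).encard : ℝ≥0∞) ≤ ∫⁻ t, liminf (fun m => c m t) atTop :=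
        lintegral_mono hle
    _ ≤ liminf (fun m => ∫⁻ t, c m t) atTop :=
        lintegral_liminf_le fun m => Measurable.tsum fun z => hAm m z
    _ ≤ μH[1] Γ := by
        refine (liminf_le_liminf (Eventually.of_forall hcint)).trans ?_
        simp

/-- A curve through `p` that reaches distance `r` from `p` has a connected piece through `p` that
stays in the closed ball of radius `r` and reaches its boundary. -/
theorem exists_isPreconnected_subset_closedBall {E : Type*} [NormedAddCommGroup E]
    {f : ℝ → E} {a b : ℝ} (hf : ContinuousOn f (Icc a b)) {p y : E}
    (hp : p ∈ f '' Icc a b) (hy : y ∈ f '' Icc a b) {r : ℝ} (hr : 0 ≤ r) (hry : r ≤ dist p y) :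
    ∃ A ⊆ f '' Icc a b, IsPreconnected A ∧ A ⊆ closedBall p r ∧ p ∈ A ∧
      ∃ p' ∈ A, dist p p' = r := by
  obtain ⟨α, hα, rfl⟩ := hp
  obtain ⟨β, hβ, rfl⟩ := hy
  set φ : ℝ → E := fun θ => f (α + θ * (β - α)) with hφ
  have hmaps : MapsTo (fun θ : ℝ => α + θ * (β - α)) (Icc 0 1) (Icc a b) := by
    rintro θ ⟨h0, h1⟩
    have := (convex_Icc a b) hα hβ (sub_nonneg.2 h1) h0 (by ring)
    simp only [smul_eq_mul] at this
    convert this using 1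
    ring
  have hφc : ContinuousOn φ (Icc 0 1) := hf.comp (by fun_prop) hmaps
  have hgc : ContinuousOn (fun θ => dist (f α) (φ θ)) (Icc 0 1) :=
    continuous_dist.comp_continuousOn (continuousOn_const.prodMk hφc)
  have hS : IsCompact (Icc (0 : ℝ) 1 ∩ (fun θ => dist (f α) (φ θ)) ⁻¹' Ici r) :=
    isCompact_Icc.of_isClosed_subset
      (hgc.preimage_isClosed_of_isClosed isClosed_Icc isClosed_Ici) inter_subset_left
  obtain ⟨τ, ⟨hτ, hτr⟩, hmin⟩ := hS.exists_isLeast ⟨1, by simp, by simpa [hφ] using hry⟩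
  have hsub : Icc 0 τ ⊆ Icc (0 : ℝ) 1 := Icc_subset_Icc_right hτ.2
  have hτeq : dist (f α) (φ τ) = r := by
    obtain ⟨θ, hθ, hθr⟩ := intermediate_value_Icc hτ.1 (hgc.mono hsub)
      (show r ∈ _ from ⟨by simpa [hφ] using hr, hτr⟩)
    have := hmin ⟨hsub hθ, hθr.ge⟩
    rwa [le_antisymm hθ.2 this] at hθr
  refine ⟨φ '' Icc 0 τ, ?_, isPreconnected_Icc.image φ (hφc.mono hsub), ?_,
    ⟨0, by simp [hτ.1], by simp [hφ]⟩, φ τ, mem_image_of_mem _ (right_mem_Icc.2 hτ.1), hτeq⟩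
  · rintro _ ⟨θ, hθ, rfl⟩
    exact mem_image_of_mem f (hmaps (hsub hθ))
  · rintro _ ⟨θ, hθ, rfl⟩
    rw [mem_closedBall']
    by_contra! h
    have : θ = τ := le_antisymm hθ.2 (hmin ⟨hsub hθ, h.le⟩)
    rw [this, hτeq] at h
    exact lt_irrefl _ h

theorem separators_comm_right {E : Type*} [NormedAddCommGroup E] [InnerProductSpace ℝ E]
    (p p' q q' : E) : separators p p' q q' = separators p p' q' q := by
  simp only [separators, mul_comm (inner ℝ _ q - _)]

/-- The hyperplanes that cross two connected subsets of `Γ ∩ closedBall c ρ` at distance at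
least `s`. -/
def crossings {E : Type*} [NormedAddCommGroup E] [InnerProductSpace ℝ E] (Γ : Set E) (c : E)
    (ρ s : ℝ) : Set (E × ℝ) :=
  {w | ∃ A ⊆ Γ ∩ closedBall c ρ, ∃ B ⊆ Γ ∩ closedBall c ρ, IsPreconnected A ∧ IsPreconnected B ∧
    (∀ a ∈ A, ∀ b ∈ B, s ≤ dist a b) ∧
    ∃ p ∈ A, ∃ p' ∈ A, ∃ q ∈ B, ∃ q' ∈ B, w ∈ separators p p' q q'}

theorem isOpen_crossings {E : Type*} [NormedAddCommGroup E] [InnerProductSpace ℝ E] (Γ : Set E)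
    (c : E) (ρ s : ℝ) : IsOpen (crossings Γ c ρ s) := by
  refine isOpen_iff_mem_nhds.2 ?_
  rintro w ⟨A, hA, B, hB, hA', hB', h, p, hp, p', hp', q, hq, q', hq', hw⟩
  exact mem_of_superset ((isOpen_separators p p' q q').mem_nhds hw) fun v hv =>
    ⟨A, hA, B, hB, hA', hB', h, p, hp, p', hp', q, hq, q', hq', hv⟩

theorem norm_sub_inner_smul_le {E : Type*} [NormedAddCommGroup E] [InnerProductSpace ℝ E] {e : E}
    (he : ‖e‖ = 1) (v : E) : ‖v - inner ℝ e v • e‖ ≤ ‖v‖ := by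
  refine le_of_sq_le_sq ?_ (norm_nonneg v)
  rw [norm_sub_sq_real, norm_smul, he, inner_smul_right, real_inner_comm, Real.norm_eq_abs, mul_one,
    sq_abs, real_inner_comm]
  nlinarith [sq_nonneg (inner ℝ e v)]

/-- If two points `a`, `a + s • e'` are within `H` of the line `ℝ e`, then so are, up to a constant,
the points within `H` of the line through them. -/
theorem norm_sub_inner_smul_le_of_le {E : Type*} [NormedAddCommGroup E] [InnerProductSpace ℝ E]
    {e e' a v : E} {s M H : ℝ} (he : ‖e‖ = 1) (he' : ‖e'‖ = 1) (hs : 0 < s)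
    (h1 : ‖a - inner ℝ e a • e‖ ≤ H)
    (h2 : ‖(a + s • e') - inner ℝ e (a + s • e') • e‖ ≤ H)
    (h3 : ‖(v - a) - inner ℝ e' (v - a) • e'‖ ≤ H) (hv : ‖v - a‖ ≤ M * s) :
    ‖v - inner ℝ e v • e‖ ≤ (2 + 2 * M) * H := by
  set τ := inner ℝ e' (v - a)
  set w := (v - a) - τ • e' with hw
  have hτ : |τ| ≤ M * s := by
    refine (abs_real_inner_le_norm _ _).trans ?_
    rwa [he', one_mul]
  have h4 : ‖e' - inner ℝ e e' • e‖ ≤ 2 * H / s := by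
    rw [le_div_iff₀ hs]
    have : s • (e' - inner ℝ e e' • e) =
        ((a + s • e') - inner ℝ e (a + s • e') • e) - (a - inner ℝ e a • e) := by
      simp only [inner_add_right, inner_smul_right]
      module
    calc ‖e' - inner ℝ e e' • e‖ * s = ‖s • (e' - inner ℝ e e' • e)‖ := by
          rw [norm_smul, Real.norm_eq_abs, abs_of_pos hs, mul_comm]
      _ ≤ H + H := by rw [this]; exact (norm_sub_le _ _).trans (add_le_add h2 h1)
      _ = 2 * H := by ring
  have h5 : v - inner ℝ e v • e = (a - inner ℝ e a • e) + τ • (e' - inner ℝ e e' • e)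
      + (w - inner ℝ e w • e) := by
    have : v = a + τ • e' + w := by rw [hw]; module
    nth_rewrite 1 2 [this]
    simp only [inner_add_right, inner_smul_right]
    module
  have hH : 0 ≤ H := (norm_nonneg _).trans h1
  calc ‖v - inner ℝ e v • e‖ ≤ H + (M * s) * (2 * H / s) + H := by
        rw [h5]
        refine norm_add₃_le.trans ?_
        rw [norm_smul, Real.norm_eq_abs]
        gcongr
        · exact (abs_nonneg _).trans hτ
        · exact (norm_sub_inner_smul_le he w).trans h3
    _ = (2 + 2 * M) * H := by field_simp; ring

/-- The part of a curve in a ball of radius comparable to `s` is close to a line if few hyperplanes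
cross well separated parts of the curve in a larger ball. -/
theorem exists_isLine_infDist_sq_le (n : ℕ) {R : ℝ} (hR : 0 ≤ R) :
    ∃ C : ℝ, 0 < C ∧ ∀ (f : ℝ → EuclideanSpace ℝ (Fin n)) (a b : ℝ), ContinuousOn f (Icc a b) →
      ∀ s : ℝ, 0 < s → (∀ x ∈ f '' Icc a b, ∃ y ∈ f '' Icc a b, 10 * s ≤ dist x y) →
      ∀ c x₀ : EuclideanSpace ℝ (Fin n), x₀ ∈ f '' Icc a b → dist x₀ c ≤ R * s →
      ∃ L, IsLine L ∧ ∀ y ∈ f '' Icc a b, dist y c ≤ R * s →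
        ENNReal.ofReal (infDist y L ^ 2) ≤ ENNReal.ofReal (C * s) *
          hyperplaneMeasure n (crossings (f '' Icc a b) c ((R + 11) * s) s) := by
  set M : ℝ := 2 * R + 11 with hM
  obtain ⟨C, hC, hsep⟩ := exists_ofReal_sq_le_hyperplaneMeasure_separators n
    (M := M) (by linarith)
  refine ⟨C * (2 + 2 * M) ^ 2, by positivity, fun f a b hf s hs hfar c x₀ hx₀ hx₀c => ?_⟩
  set Γ := f '' Icc a b
  have arc : ∀ x ∈ Γ, ∃ A ⊆ Γ, IsPreconnected A ∧ A ⊆ closedBall x s ∧ x ∈ A ∧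
      ∃ x' ∈ A, dist x x' = s := by
    intro x hx
    obtain ⟨y, hy, hxy⟩ := hfar x hx
    exact exists_isPreconnected_subset_closedBall hf hx hy hs.le (by linarith)
  set m := hyperplaneMeasure n (crossings Γ c ((R + 11) * s) s) with hm
  obtain ⟨x₁, hx₁, hx₀₁⟩ : ∃ x₁ ∈ Γ, dist x₀ x₁ = 10 * s := by
    obtain ⟨y, hy, hxy⟩ := hfar x₀ hx₀
    obtain ⟨A, hA, -, -, -, x₁, hx₁, h⟩ :=
      exists_isPreconnected_subset_closedBall hf hx₀ hy (by positivity) hxy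
    exact ⟨x₁, hA hx₁, h⟩
  obtain ⟨A₀, hA₀, hA₀c, hA₀s, hx₀A, x₀', hx₀'A, hx₀'⟩ := arc x₀ hx₀
  obtain ⟨A₁, hA₁, hA₁c, hA₁s, hx₁A, x₁', hx₁'A, hx₁'⟩ := arc x₁ hx₁
  have hx₁c : dist x₁ c ≤ (R + 10) * s := by
    have := dist_triangle_left x₁ c x₀
    linarith
  have hball : ∀ {x A}, dist x c ≤ (R + 10) * s → A ⊆ Γ → A ⊆ closedBall x s →
      A ⊆ Γ ∩ closedBall c ((R + 11) * s) := by
    refine fun {x A} hx hA hAs y hy => ⟨hA hy, mem_closedBall.2 ?_⟩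
    have := mem_closedBall.1 (hAs hy)
    have := dist_triangle y x c
    linarith
  have hcross : ∀ {p p' q q' A B}, IsPreconnected A → IsPreconnected B → dist p c ≤ (R + 10) * s →
      dist q c ≤ (R + 10) * s → A ⊆ Γ → B ⊆ Γ → A ⊆ closedBall p s → B ⊆ closedBall q s →
      5 * s ≤ dist p q → p ∈ A → p' ∈ A → q ∈ B → q' ∈ B →
      hyperplaneMeasure n (separators p p' q q') ≤ m := by
    intro p p' q q' A B hA hB hpc hqc hAΓ hBΓ hAs hBs hpq hp hp' hq hq'
    refine measure_mono fun w hw => ⟨A, hball hpc hAΓ hAs, B, hball hqc hBΓ hBs, hA, hB, ?_,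
      p, hp, p', hp', q, hq, q', hq', hw⟩
    intro x hx y hy
    have h1 := mem_closedBall'.1 (hAs hx)
    have h2 := mem_closedBall.1 (hBs hy)
    have := dist_triangle4 p x y q
    linarith
  set e := s⁻¹ • (x₀' - x₀) with he
  set e₁ := s⁻¹ • (x₁' - x₁) with he₁
  have hnorm : ∀ {x x' : EuclideanSpace ℝ (Fin n)}, dist x x' = s → ‖s⁻¹ • (x' - x)‖ = 1 := by
    intro x x' h
    rw [norm_smul, ← dist_eq_norm, dist_comm, h, Real.norm_eq_abs, abs_of_pos (by positivity),
      inv_mul_cancel₀ hs.ne']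
  refine ⟨{x | ∃ t : ℝ, x = x₀ + t • e}, ⟨x₀, e, ?_, rfl⟩, fun y hy hyc => ?_⟩
  · rw [← norm_ne_zero_iff, hnorm hx₀']; exact one_ne_zero
  by_cases hmtop : m = ⊤
  · rw [hmtop, ENNReal.mul_top (by simp; positivity)]
    exact le_top
  set H := √(C * s * m.toReal) with hH
  have hHle : ∀ {v : EuclideanSpace ℝ (Fin n)} {m' : ℝ≥0∞}, m' ≤ m →
      ENNReal.ofReal (‖v‖ ^ 2) ≤ ENNReal.ofReal (C * s) * m' → ‖v‖ ≤ H := by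
    intro v m' hm' h
    refine Real.le_sqrt_of_sq_le ?_
    rw [← ENNReal.ofReal_le_ofReal_iff (by positivity), ENNReal.ofReal_mul (by positivity),
      ENNReal.ofReal_toReal hmtop]
    exact h.trans (by gcongr)
  have main : ‖(y - x₀) - inner ℝ e (y - x₀) • e‖ ≤ (2 + 2 * M) * H := by
    obtain ⟨A₂, hA₂, hA₂c, hA₂s, hyA, y', hy'A, hy'⟩ := arc y hy
    have hn : ∀ {x x' : EuclideanSpace ℝ (Fin n)}, dist x x' = s → ‖x' - x‖ = s := by
      intro x x' h
      rw [← dist_eq_norm, dist_comm, h]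
    have hyx₀ : dist x₀ y ≤ 2 * R * s := by
      have := dist_triangle_right x₀ y c
      linarith
    have hRs : 0 ≤ R * s := by positivity
    by_cases hfar₀ : 5 * s ≤ dist x₀ y
    · refine (hHle (hcross hA₀c hA₂c (by linarith) (by linarith) hA₀ hA₂ hA₀s hA₂s hfar₀ hx₀A hx₀'A
        hyA hy'A) (hsep x₀ x₀' y y' s hs (hn hx₀') (hn hy') ?_)).trans ?_
      · rw [← dist_eq_norm, dist_comm, hM]; linarith
      · have : 0 ≤ H := Real.sqrt_nonneg _
        nlinarith
    have hfar₁ : 5 * s ≤ dist x₁ y := by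
      have := dist_triangle_right x₀ x₁ y
      linarith
    have hyx₁ : dist x₁ y ≤ M * s := by
      have := dist_triangle_left x₁ y x₀
      rw [hM]; linarith
    refine norm_sub_inner_smul_le_of_le (a := x₁ - x₀) (e' := e₁) (s := s) (hnorm hx₀') (hnorm hx₁')
      hs ?_ ?_ ?_ ?_
    · refine hHle (hcross hA₀c hA₁c (by linarith) hx₁c hA₀ hA₁ hA₀s hA₁s (by linarith) hx₀A hx₀'A
        hx₁A hx₁'A) (hsep x₀ x₀' x₁ x₁' s hs (hn hx₀') (hn hx₁') ?_)
      rw [← dist_eq_norm, dist_comm, hM]; linarith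
    · have h1 : x₁ - x₀ + s • e₁ = x₁' - x₀ := by
        rw [he₁, smul_smul, mul_inv_cancel₀ hs.ne']
        module
      rw [h1]
      refine hHle ?_ (hsep x₀ x₀' x₁' x₁ s hs (hn hx₀') (by rw [← dist_eq_norm, hx₁']) ?_)
      · rw [separators_comm_right]
        exact hcross hA₀c hA₁c (by linarith) hx₁c hA₀ hA₁ hA₀s hA₁s (by linarith) hx₀A hx₀'A
          hx₁A hx₁'A
      · have := dist_triangle x₀ x₁ x₁'
        rw [← dist_eq_norm, dist_comm, hM]; linarith
    · rw [sub_sub_sub_cancel_right]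
      refine hHle (hcross hA₁c hA₂c hx₁c (by linarith) hA₁ hA₂ hA₁s hA₂s hfar₁ hx₁A hx₁'A
        hyA hy'A) (hsep x₁ x₁' y y' s hs (hn hx₁') (hn hy') ?_)
      rw [← dist_eq_norm, dist_comm]; exact hyx₁
    · rw [sub_sub_sub_cancel_right, ← dist_eq_norm, dist_comm]; exact hyx₁
  calc ENNReal.ofReal (infDist y {x | ∃ t : ℝ, x = x₀ + t • e} ^ 2)
      ≤ ENNReal.ofReal (((2 + 2 * M) * H) ^ 2) := by
        have : infDist y {x | ∃ t : ℝ, x = x₀ + t • e} ≤ (2 + 2 * M) * H := by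
          have hmem : x₀ + inner ℝ e (y - x₀) • e ∈ {x | ∃ t : ℝ, x = x₀ + t • e} := ⟨_, rfl⟩
          refine (infDist_le_dist_of_mem hmem).trans ?_
          rwa [dist_eq_norm, ← sub_sub]
        gcongr
        exact infDist_nonneg
    _ = ENNReal.ofReal (C * (2 + 2 * M) ^ 2 * s) * m := by
        rw [mul_pow, hH, Real.sq_sqrt (by positivity), ← mul_assoc,
          ENNReal.ofReal_mul (by positivity),
          ENNReal.ofReal_toReal hmtop]
        ring_nf

theorem exists_separated_superset {X : Type*} [PseudoMetricSpace X] (P S : Finset X) (hS : S ⊆ P)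
    {ε : ℝ} (hsep : ∀ x ∈ S, ∀ y ∈ S, x ≠ y → ε ≤ dist x y) :
    ∃ T ⊆ P, S ⊆ T ∧ (∀ x ∈ T, ∀ y ∈ T, x ≠ y → ε ≤ dist x y) ∧
      ∀ x ∈ P, ∃ y ∈ T, x = y ∨ dist x y < ε := by
  classical
  obtain ⟨T, hT, hmax⟩ := (P.powerset.filter fun T => S ⊆ T ∧
    ∀ x ∈ T, ∀ y ∈ T, x ≠ y → ε ≤ dist x y).exists_max_image Finset.card
    ⟨S, by simp only [Finset.mem_filter, Finset.mem_powerset]; exact ⟨hS, subset_rfl, hsep⟩⟩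
  simp only [Finset.mem_filter, Finset.mem_powerset] at hT hmax
  obtain ⟨hTP, hST, hTsep⟩ := hT
  refine ⟨T, hTP, hST, hTsep, fun x hx => ?_⟩
  by_contra! h
  have hxT : x ∉ T := fun hxT => (h x hxT).1 rfl
  have := hmax (insert x T) ⟨Finset.insert_subset hx hTP,
    hST.trans (Finset.subset_insert x T), by
      intro y hy z hz hyz
      rcases Finset.mem_insert.1 hy with hyx | hy <;> rcases Finset.mem_insert.1 hz with hzx | hz
      · exact absurd (hyx.trans hzx.symm) hyz
      · rw [hyx]; exact (h z hz).2
      · rw [hzx, dist_comm]; exact (h y hy).2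
      · exact hTsep y hy z hz hyz⟩
  rw [Finset.card_insert_of_notMem hxT] at this
  omega

theorem exists_nested_nets {X : Type*} [PseudoMetricSpace X] (P : Finset X) {ε : ℕ → ℝ}
    (hε : Antitone ε) :
    ∃ N : ℕ → Finset X, Monotone N ∧ (∀ j, ∀ x ∈ N j, ∀ y ∈ N j, x ≠ y → ε j ≤ dist x y) ∧
      (∀ j, N j ⊆ P) ∧ ∀ j, ∀ x ∈ P, ∃ y ∈ N j, x = y ∨ dist x y < ε j := by
  have step : ∀ (j : ℕ) (S : {S : Finset X // S ⊆ P ∧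
      ∀ x ∈ S, ∀ y ∈ S, x ≠ y → ε j ≤ dist x y}),
      ∃ T : Finset X, (T ⊆ P ∧ ∀ x ∈ T, ∀ y ∈ T, x ≠ y → ε j ≤ dist x y) ∧ S.1 ⊆ T ∧
        ∀ x ∈ P, ∃ y ∈ T, x = y ∨ dist x y < ε j := by
    rintro j ⟨S, hS, hsep⟩
    obtain ⟨T, h1, h2, h3, h4⟩ := exists_separated_superset P S hS hsep
    exact ⟨T, ⟨h1, h3⟩, h2, h4⟩
  choose T hT hST hdense using step
  let N : (j : ℕ) → {S : Finset X // S ⊆ P ∧ ∀ x ∈ S, ∀ y ∈ S, x ≠ y → ε j ≤ dist x y} :=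
    fun j => Nat.rec ⟨T 0 ⟨∅, by simp, by simp⟩, hT 0 _⟩
      (fun j S => ⟨T (j + 1) ⟨S.1, S.2.1, fun x hx y hy hxy =>
        (hε j.le_succ).trans (S.2.2 x hx y hy hxy)⟩, hT (j + 1) _⟩) j
  refine ⟨fun j => (N j).1, monotone_nat_of_le_succ fun j => hST (j + 1) ⟨(N j).1, (N j).2.1,
    fun x hx y hy hxy => (hε j.le_succ).trans ((N j).2.2 x hx y hy hxy)⟩,
    fun j => (N j).2.2, fun j => (N j).2.1, fun j => ?_⟩
  cases j with
  | zero => exact hdense 0 _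
  | succ j => exact hdense (j + 1) _

/-- The center of the dyadic cube of generation `k` with corner `z`. -/
def dyadicCenter (n : ℕ) (k : ℤ) (z : Fin n → ℤ) : EuclideanSpace ℝ (Fin n) :=
  WithLp.toLp 2 fun i => ((z i : ℝ) + 1 / 2) * (2 : ℝ) ^ (-k)

theorem abs_sub_apply_le_dist {n : ℕ} (x y : EuclideanSpace ℝ (Fin n)) (i : Fin n) :
    |x i - y i| ≤ dist x y := by
  rw [EuclideanSpace.dist_eq]
  refine Real.le_sqrt_of_sq_le ?_
  rw [sq_abs]
  have := Finset.single_le_sum (f := fun i => dist (x i) (y i) ^ 2)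
    (fun i _ => sq_nonneg _) (Finset.mem_univ i)
  simpa only [Real.dist_eq, sq_abs] using this

theorem abs_sub_floor_le_of_dist_dyadicCenter_le {n : ℕ} {k : ℤ} {z : Fin n → ℤ}
    {x : EuclideanSpace ℝ (Fin n)} {R : ℝ}
    (h : dist x (dyadicCenter n k z) ≤ R * (2 : ℝ) ^ (-k)) (i : Fin n) :
    |z i - ⌊(2 : ℝ) ^ k * x i⌋| ≤ ⌈R⌉ + 2 := by
  have hk : (0 : ℝ) < 2 ^ (-k) := by positivity
  have h1 : |x i - ((z i : ℝ) + 1 / 2) * (2 : ℝ) ^ (-k)| ≤ R * (2 : ℝ) ^ (-k) :=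
    (abs_sub_apply_le_dist x (dyadicCenter n k z) i).trans h
  have hkk : (2 : ℝ) ^ k * 2 ^ (-k) = 1 := by
    rw [← zpow_add₀ two_ne_zero]; simp
  have h2 : |(2 : ℝ) ^ k * x i - ((z i : ℝ) + 1 / 2)| ≤ R := by
    have : (2 : ℝ) ^ k * x i - ((z i : ℝ) + 1 / 2)
        = 2 ^ k * (x i - ((z i : ℝ) + 1 / 2) * (2 : ℝ) ^ (-k)) := by
      linear_combination ((z i : ℝ) + 1 / 2) * hkk
    rw [this, abs_mul, abs_of_pos (by positivity)]
    calc (2 : ℝ) ^ k * |x i - ((z i : ℝ) + 1 / 2) * (2 : ℝ) ^ (-k)|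
        ≤ 2 ^ k * (R * 2 ^ (-k)) := by gcongr
      _ = R := by linear_combination R * hkk
  have h3 := Int.floor_le ((2 : ℝ) ^ k * x i)
  have h4 := Int.lt_floor_add_one ((2 : ℝ) ^ k * x i)
  have h5 := Int.le_ceil R
  have h6 : |(z i : ℝ) - ⌊(2 : ℝ) ^ k * x i⌋| ≤ ⌈R⌉ + 2 := by
    rw [abs_le] at h2 ⊢
    constructor <;> linarith
  exact_mod_cast h6

/-- Among `N` points there are pairs of points at distance comparable to the side length near at
most a constant multiple of `N` dyadic cubes. -/
theorem exists_card_le_mul_card (n : ℕ) (R : ℝ) :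
    ∃ C : ℕ, ∀ (P : Finset (EuclideanSpace ℝ (Fin n))) (F : Finset (ℤ × (Fin n → ℤ))),
      (∀ Q ∈ F, ∃ x ∈ P, ∃ y ∈ P, dist x (dyadicCenter n Q.1 Q.2) ≤ R * (2 : ℝ) ^ (-Q.1) ∧
        dist y (dyadicCenter n Q.1 Q.2) ≤ R * (2 : ℝ) ^ (-Q.1) ∧ (2 : ℝ) ^ (-Q.1) ≤ dist x y) →
      F.card ≤ C * P.card := by
  classical
  obtain ⟨m, hm⟩ := pow_unbounded_of_one_lt (2 * R + 1) (one_lt_two (α := ℝ))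
  set W : Finset (Fin n → ℤ) :=
    Fintype.piFinset fun _ => Finset.Icc (-(⌈R + 1⌉ + 2)) (⌈R + 1⌉ + 2) with hW
  refine ⟨(Finset.Icc (-2 : ℤ) m ×ˢ W).card, fun P F hF => ?_⟩
  rcases F.eq_empty_or_nonempty with rfl | hFne
  · simp
  obtain ⟨Q₀, -, hQ₀⟩ := F.exists_min_image Prod.fst hFne
  set k₀ := Q₀.1
  obtain ⟨N, hmono, hsep, hNP, hdense⟩ := exists_nested_nets P
    (ε := fun j => (2 : ℝ) ^ (-(k₀ + j))) (fun i j hij => by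
      apply zpow_le_zpow_right₀ one_le_two
      have : (i : ℤ) ≤ j := by exact_mod_cast hij
      linarith)
  set b : EuclideanSpace ℝ (Fin n) → ℕ := fun p => sInf {j | p ∈ N j} with hb
  have key : ∀ Q ∈ F, ∃ p ∈ P, dist p (dyadicCenter n Q.1 Q.2) ≤ (R + 1) * (2 : ℝ) ^ (-Q.1) ∧
      Q.1 - k₀ - b p ∈ Finset.Icc (-2 : ℤ) m := by
    intro Q hQ
    obtain ⟨x, hx, y, hy, hxQ, hyQ, hxy⟩ := hF Q hQ
    obtain ⟨j, hj⟩ : ∃ j : ℕ, Q.1 = k₀ + j :=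
      ⟨(Q.1 - k₀).toNat, by rw [Int.toNat_of_nonneg (by linarith [hQ₀ Q hQ])]; ring⟩
    set s : ℝ := (2 : ℝ) ^ (-Q.1) with hs
    have hspos : 0 < s := by positivity
    have hs4 : (2 : ℝ) ^ (-(k₀ + ((j + 2 : ℕ) : ℤ))) = s / 4 := by
      rw [hs, hj, show -(k₀ + ((j + 2 : ℕ) : ℤ)) = -(k₀ + j) - 2 by push_cast; ring,
        zpow_sub₀ two_ne_zero]
      norm_num
    have near : ∀ v ∈ P, ∃ v' ∈ N (j + 2), dist v v' ≤ s / 4 := by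
      intro v hv
      obtain ⟨v', hv', h⟩ := hdense (j + 2) v hv
      refine ⟨v', hv', ?_⟩
      rcases h with rfl | h
      · rw [dist_self]; positivity
      · rw [hs4] at h; exact h.le
    obtain ⟨x', hx', hxx'⟩ := near x hx
    obtain ⟨y', hy', hyy'⟩ := near y hy
    have hne : x' ≠ y' := by
      rintro rfl
      have := dist_triangle_right x y x'
      linarith
    have hx'y' : dist x' y' ≤ (2 * R + 1) * s := by
      have h1 := dist_triangle4 x' x y y'
      have h2 := dist_triangle_right x y (dyadicCenter n Q.1 Q.2)
      rw [dist_comm x' x] at h1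
      linarith
    have hbx : x' ∈ N (b x') := Nat.sInf_mem (s := {j | x' ∈ N j}) ⟨_, hx'⟩
    have hby : y' ∈ N (b y') := Nat.sInf_mem (s := {j | y' ∈ N j}) ⟨_, hy'⟩
    have hbx2 : b x' ≤ j + 2 := Nat.sInf_le (s := {j | x' ∈ N j}) hx'
    have hby2 : b y' ≤ j + 2 := Nat.sInf_le (s := {j | y' ∈ N j}) hy'
    have hbig : j ≤ b x' + m ∨ j ≤ b y' + m := by
      by_contra! h
      obtain ⟨i, rfl⟩ : ∃ i, j = i + m := ⟨j - m, by omega⟩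
      have := hsep i x' (hmono (by omega : b x' ≤ i) hbx) y' (hmono (by omega : b y' ≤ i) hby) hne
      have hi : (2 : ℝ) ^ (-(k₀ + (i : ℤ))) = 2 ^ m * s := by
        rw [hs, hj, ← zpow_natCast, ← zpow_add₀ two_ne_zero]
        congr 1
        push_cast
        ring
      rw [hi] at this
      have : 2 ^ m * s ≤ (2 * R + 1) * s := this.trans hx'y'
      exact absurd (le_of_mul_le_mul_right this hspos) (not_le.2 hm)
    rcases hbig with h | h
    · refine ⟨x', hNP _ hx', ?_, Finset.mem_Icc.2 ⟨?_, ?_⟩⟩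
      · have := dist_triangle_left x' (dyadicCenter n Q.1 Q.2) x
        linarith
      · rw [hj]; omega
      · rw [hj]; omega
    · refine ⟨y', hNP _ hy', ?_, Finset.mem_Icc.2 ⟨?_, ?_⟩⟩
      · have := dist_triangle_left y' (dyadicCenter n Q.1 Q.2) y
        linarith
      · rw [hj]; omega
      · rw [hj]; omega
  choose! p hpP hpQ hpk using key
  calc F.card ≤ (P ×ˢ (Finset.Icc (-2 : ℤ) m ×ˢ W)).card := by
        refine Finset.card_le_card_of_injOn
          (fun Q => (p Q, Q.1 - k₀ - b (p Q), fun i => Q.2 i - ⌊(2 : ℝ) ^ Q.1 * p Q i⌋)) ?_ ?_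
        · intro Q hQ
          refine Finset.mem_product.2 ⟨hpP Q hQ, Finset.mem_product.2 ⟨hpk Q hQ, ?_⟩⟩
          exact Fintype.mem_piFinset.2 fun i => Finset.mem_Icc.2
            (abs_le.1 (abs_sub_floor_le_of_dist_dyadicCenter_le (hpQ Q hQ) i))
        · intro Q _ Q' _ h
          simp only [Prod.mk.injEq] at h
          obtain ⟨h1, h2, h3⟩ := h
          have hk : Q.1 = Q'.1 := by rw [h1] at h2; linarith
          refine Prod.ext hk (funext fun i => ?_)
          have := congrFun h3 i
          rw [h1, hk] at this
          linarith
    _ = (Finset.Icc (-2 : ℤ) m ×ˢ W).card * P.card := by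
        rw [Finset.card_product, mul_comm]

theorem exists_inner_eq_of_mul_neg {E : Type*} [NormedAddCommGroup E] [InnerProductSpace ℝ E]
    {A : Set E} (hA : IsPreconnected A) {p p' u : E} {t : ℝ} (hp : p ∈ A) (hp' : p' ∈ A)
    (h : (inner ℝ u p - t) * (inner ℝ u p' - t) < 0) : ∃ a ∈ A, inner ℝ u a = t := by
  have hc : ContinuousOn (fun x => inner ℝ u x) A := by fun_prop
  rcases mul_neg_iff.1 h with ⟨h1, h2⟩ | ⟨h1, h2⟩
  · exact hA.intermediate_value hp' hp hc ⟨by linarith, by linarith⟩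
  · exact hA.intermediate_value hp hp' hc ⟨by linarith, by linarith⟩

/-- Crofton-type bound: the hyperplanes crossing well separated parts of `Γ` near dyadic cubes have
total measure bounded by the length of `Γ`. -/
theorem sum_hyperplaneMeasure_crossings_le (n : ℕ) (R : ℝ) :
    ∃ C : ℝ≥0∞, C ≠ ⊤ ∧ ∀ (Γ : Set (EuclideanSpace ℝ (Fin n))) (F : Finset (ℤ × (Fin n → ℤ))),
      ∑ Q ∈ F, hyperplaneMeasure n (crossings Γ (dyadicCenter n Q.1 Q.2) (R * (2 : ℝ) ^ (-Q.1))
        ((2 : ℝ) ^ (-Q.1))) ≤ C * μH[1] Γ := by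
  classical
  obtain ⟨C, hC⟩ := exists_card_le_mul_card n R
  refine ⟨(C + 1) * volume (ball (0 : EuclideanSpace ℝ (Fin n)) 1),
    ENNReal.mul_ne_top (by finiteness) measure_ball_lt_top.ne, fun Γ F => ?_⟩
  set G : ℤ × (Fin n → ℤ) → Set (EuclideanSpace ℝ (Fin n) × ℝ) := fun Q =>
    crossings Γ (dyadicCenter n Q.1 Q.2) (R * (2 : ℝ) ^ (-Q.1)) ((2 : ℝ) ^ (-Q.1)) with hG
  have hGm : ∀ Q, MeasurableSet (G Q) := fun Q => (isOpen_crossings _ _ _ _).measurableSet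
  have hcount : ∀ u t, ∑ Q ∈ F, (Prod.mk u ⁻¹' G Q).indicator (1 : ℝ → ℝ≥0∞) t ≤
      (C + 1) * ((Γ ∩ (fun x => inner ℝ u x) ⁻¹' {t}).encard : ℝ≥0∞) := by
    intro u t
    by_cases hfin : (Γ ∩ (fun x => inner ℝ u x) ⁻¹' {t}).Finite
    · have := hC hfin.toFinset (F.filter fun Q => (u, t) ∈ G Q) fun Q hQ => by
        obtain ⟨A, hA, B, hB, hA', hB', hAB, p, hp, p', hp', q, hq, q', hq', h1, h2⟩ :=
          (Finset.mem_filter.1 hQ).2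
        obtain ⟨x, hx, hxt⟩ := exists_inner_eq_of_mul_neg hA' hp hp' h1
        obtain ⟨y, hy, hyt⟩ := exists_inner_eq_of_mul_neg hB' hq hq' h2
        exact ⟨x, by simpa using ⟨(hA hx).1, hxt⟩, y, by simpa using ⟨(hB hy).1, hyt⟩,
          (hA hx).2, (hB hy).2, hAB x hx y hy⟩
      calc ∑ Q ∈ F, (Prod.mk u ⁻¹' G Q).indicator (1 : ℝ → ℝ≥0∞) t
          = ((F.filter fun Q => (u, t) ∈ G Q).card : ℝ≥0∞) := by
            simp [indicator_apply]
        _ ≤ ((C * hfin.toFinset.card : ℕ) : ℝ≥0∞) := by exact_mod_cast this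
        _ ≤ _ := by
            rw [hfin.encard_eq_coe_toFinset_card]
            push_cast
            gcongr
            exact le_self_add
    · rw [Set.not_finite.1 hfin |>.encard_eq]
      simp
  have hslice : ∀ u ∈ ball (0 : EuclideanSpace ℝ (Fin n)) 1,
      ∑ Q ∈ F, volume (Prod.mk u ⁻¹' G Q) ≤ (C + 1) * μH[1] Γ := by
    intro u hu
    have hmeas : ∀ Q, MeasurableSet (Prod.mk u ⁻¹' G Q) := fun Q => measurable_prodMk_left (hGm Q)
    have hlip : LipschitzWith 1 fun x : EuclideanSpace ℝ (Fin n) => (inner ℝ u x : ℝ) :=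
      LipschitzWith.of_dist_le_mul fun x y => by
        rw [Real.dist_eq, ← inner_sub_right, dist_eq_norm]
        refine (abs_real_inner_le_norm _ _).trans ?_
        gcongr
        simpa using (mem_ball_zero_iff.1 hu).le
    calc ∑ Q ∈ F, volume (Prod.mk u ⁻¹' G Q)
        = ∫⁻ t, ∑ Q ∈ F, (Prod.mk u ⁻¹' G Q).indicator (1 : ℝ → ℝ≥0∞) t := by
          rw [lintegral_finsetSum _ fun Q _ => measurable_one.indicator (hmeas Q)]
          simp only [lintegral_indicator_one (hmeas _)]
      _ ≤ ∫⁻ t, (C + 1) * ((Γ ∩ (fun x => inner ℝ u x) ⁻¹' {t}).encard : ℝ≥0∞) :=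
          lintegral_mono (hcount u)
      _ = (C + 1) * ∫⁻ t, ((Γ ∩ (fun x => inner ℝ u x) ⁻¹' {t}).encard : ℝ≥0∞) :=
          lintegral_const_mul' _ _ (by finiteness)
      _ ≤ (C + 1) * μH[1] Γ := by gcongr; exact lintegral_encard_fiber_le Γ hlip
  calc ∑ Q ∈ F, hyperplaneMeasure n (G Q)
      = ∫⁻ u in ball 0 1, ∑ Q ∈ F, volume (Prod.mk u ⁻¹' G Q) := by
        rw [lintegral_finsetSum _ fun Q _ => measurable_measure_prodMk_left (hGm Q)]
        simp only [hyperplaneMeasure, Measure.prod_apply (hGm _)]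
    _ ≤ ∫⁻ u in ball (0 : EuclideanSpace ℝ (Fin n)) 1, (C + 1) * μH[1] Γ :=
        setLIntegral_mono measurable_const hslice
    _ = _ := by rw [setLIntegral_const]; ring

theorem sum_two_zpow_le {S : Finset ℤ} {m : ℤ} (hS : ∀ k ∈ S, k ≤ m) :
    ∑ k ∈ S, (2 : ℝ) ^ k ≤ 2 * 2 ^ m := by
  have hinj : Set.InjOn (fun k : ℤ => (m - k).toNat) S := by
    intro k hk l hl h
    have h1 := hS k hk
    have h2 := hS l hl
    simp only at h
    omega
  calc ∑ k ∈ S, (2 : ℝ) ^ k = ∑ k ∈ S, (1 / 2 : ℝ) ^ (m - k).toNat * 2 ^ m := by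
        refine Finset.sum_congr rfl fun k hk => ?_
        have : ((m - k).toNat : ℤ) = m - k := Int.toNat_of_nonneg (by linarith [hS k hk])
        rw [← zpow_natCast, this, one_div, inv_zpow', ← zpow_add₀ two_ne_zero]
        congr 1
        ring
    _ = (∑ j ∈ S.image fun k => (m - k).toNat, (1 / 2 : ℝ) ^ j) * 2 ^ m := by
        rw [Finset.sum_image hinj, Finset.sum_mul]
    _ ≤ 2 * 2 ^ m := by
        gcongr
        exact (summable_geometric_two.sum_le_tsum _ fun _ _ => by positivity).trans
          tsum_geometric_two.le

/-- The reciprocals of the side lengths of the dyadic cubes around `x` of side length at least a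
constant multiple of `d` have sum at most a constant multiple of `1 / d`. -/
theorem sum_ofReal_mul_two_zpow_le (n : ℕ) (R K : ℝ) :
    ∃ C : ℝ≥0∞, C ≠ ⊤ ∧ ∀ (x : EuclideanSpace ℝ (Fin n)) (d : ℝ), 0 ≤ d →
      ∀ F : Finset (ℤ × (Fin n → ℤ)), (∀ Q ∈ F, d ≤ K * (2 : ℝ) ^ (-Q.1) ∧
        dist x (dyadicCenter n Q.1 Q.2) ≤ R * (2 : ℝ) ^ (-Q.1)) →
      ∑ Q ∈ F, ENNReal.ofReal (d * 2 ^ Q.1) ≤ C := by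
  classical
  set W : Finset (Fin n → ℤ) := Fintype.piFinset fun _ => Finset.Icc (-(⌈R⌉ + 2)) (⌈R⌉ + 2) with hW
  refine ⟨ENNReal.ofReal (W.card * (2 * K)), ENNReal.ofReal_ne_top, fun x d hd F hF => ?_⟩
  rcases F.eq_empty_or_nonempty with rfl | hFne
  · simp
  obtain ⟨Q₀, hQ₀F, hQ₀⟩ := F.exists_max_image Prod.fst hFne
  rw [← ENNReal.ofReal_sum_of_nonneg fun _ _ => by positivity]
  refine ENNReal.ofReal_le_ofReal ?_
  have hinj : Set.InjOn (fun Q : ℤ × (Fin n → ℤ) => (Q.1, fun i => Q.2 i - ⌊(2 : ℝ) ^ Q.1 * x i⌋))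
      F := by
    intro Q _ Q' _ h
    simp only [Prod.mk.injEq] at h
    refine Prod.ext h.1 (funext fun i => ?_)
    have := congrFun h.2 i
    rw [h.1] at this
    linarith
  have hKd : d * 2 ^ Q₀.1 ≤ K := by
    have h := (hF Q₀ hQ₀F).1
    rwa [zpow_neg, ← div_eq_mul_inv, le_div_iff₀ (by positivity)] at h
  calc ∑ Q ∈ F, d * (2 : ℝ) ^ Q.1
      = ∑ Q ∈ F.image fun Q => (Q.1, fun i => Q.2 i - ⌊(2 : ℝ) ^ Q.1 * x i⌋),
          d * (2 : ℝ) ^ Q.1 := by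
        rw [Finset.sum_image hinj]
    _ ≤ ∑ Q ∈ F.image Prod.fst ×ˢ W, d * (2 : ℝ) ^ Q.1 := by
        refine Finset.sum_le_sum_of_subset_of_nonneg ?_ fun _ _ _ => by positivity
        intro Q' hQ'
        obtain ⟨Q, hQ, rfl⟩ := Finset.mem_image.1 hQ'
        exact Finset.mem_product.2 ⟨Finset.mem_image.2 ⟨Q, hQ, rfl⟩,
          Fintype.mem_piFinset.2 fun i => Finset.mem_Icc.2
            (abs_le.1 (abs_sub_floor_le_of_dist_dyadicCenter_le (hF Q hQ).2 i))⟩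
    _ = W.card * (d * ∑ k ∈ F.image Prod.fst, (2 : ℝ) ^ k) := by
        rw [Finset.sum_product, Finset.mul_sum, Finset.mul_sum]
        simp
    _ ≤ W.card * (d * (2 * 2 ^ Q₀.1)) := by
        gcongr
        refine sum_two_zpow_le fun k hk => ?_
        obtain ⟨Q, hQ, rfl⟩ := Finset.mem_image.1 hk
        exact hQ₀ Q hQ
    _ ≤ W.card * (2 * K) := by
        refine mul_le_mul_of_nonneg_left ?_ (by positivity)
        linarith

theorem dist_le_mul_of_abs_sub_le {n : ℕ} {x y : EuclideanSpace ℝ (Fin n)} {t : ℝ} (ht : 0 ≤ t)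
    (h : ∀ i, |x i - y i| ≤ t) : dist x y ≤ n * t := by
  rw [EuclideanSpace.dist_eq]
  refine Real.sqrt_le_iff.2 ⟨by positivity, ?_⟩
  calc ∑ i, dist (x i) (y i) ^ 2 ≤ ∑ _i : Fin n, t ^ 2 := by
        gcongr with i
        exact h i
    _ = n * t ^ 2 := by simp
    _ ≤ (n * t) ^ 2 := by
        have : (n : ℝ) ≤ (n : ℝ) ^ 2 := by exact_mod_cast Nat.le_self_pow two_ne_zero n
        rw [mul_pow]
        gcongr

theorem abs_sub_dyadicCenter_le_of_mem_dyadicCube {n : ℕ} {k : ℤ} {z : Fin n → ℤ}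
    {x : EuclideanSpace ℝ (Fin n)} (hx : x ∈ dyadicCube n k z) (i : Fin n) :
    |x i - dyadicCenter n k z i| ≤ (2 : ℝ) ^ (-k) / 2 := by
  have := hx i
  simp only [dyadicCenter]
  rw [abs_le]
  constructor <;> linarith

theorem dist_dyadicCenter_le_of_mem_dyadicCube {n : ℕ} {k : ℤ} {z : Fin n → ℤ}
    {x : EuclideanSpace ℝ (Fin n)} (hx : x ∈ dyadicCube n k z) :
    dist x (dyadicCenter n k z) ≤ n * (2 : ℝ) ^ (-k) := by
  have h : (0 : ℝ) < 2 ^ (-k) := by positivity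
  exact dist_le_mul_of_abs_sub_le h.le fun i =>
    (abs_sub_dyadicCenter_le_of_mem_dyadicCube hx i).trans (half_le_self h.le)

theorem dist_dyadicCenter_le_of_mem_dilatedCube {n : ℕ} {k : ℤ} {z : Fin n → ℤ}
    {x : EuclideanSpace ℝ (Fin n)} (hx : x ∈ dilatedCube n 3 k z) :
    dist x (dyadicCenter n k z) ≤ 2 * n * (2 : ℝ) ^ (-k) := by
  have h : (0 : ℝ) < 2 ^ (-k) := by positivity
  refine (dist_le_mul_of_abs_sub_le (t := 2 * (2 : ℝ) ^ (-k)) (by positivity)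
    fun i => (hx i).trans (by linarith)).trans_eq (by ring)

theorem diam_dyadicCube_le (n : ℕ) (k : ℤ) (z : Fin n → ℤ) :
    diam (dyadicCube n k z) ≤ n * (2 : ℝ) ^ (-k) := by
  refine diam_le_of_forall_dist_le (by positivity) fun x hx y hy =>
    dist_le_mul_of_abs_sub_le (by positivity) fun i => ?_
  have h1 := abs_le.1 (abs_sub_dyadicCenter_le_of_mem_dyadicCube hx i)
  have h2 := abs_le.1 (abs_sub_dyadicCenter_le_of_mem_dyadicCube hy i)
  rw [abs_le]
  constructor <;> linarith

theorem closedBall_subset_dilatedCube {n : ℕ} {k : ℤ} {z : Fin n → ℤ}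
    {x : EuclideanSpace ℝ (Fin n)} (hx : x ∈ dyadicCube n k z) :
    closedBall x ((2 : ℝ) ^ (-k)) ⊆ dilatedCube n 3 k z := by
  intro y hy i
  have h1 := (abs_sub_apply_le_dist y x i).trans (mem_closedBall.1 hy)
  have h2 : |x i - ((z i : ℝ) + 1 / 2) * (2 : ℝ) ^ (-k)| ≤ _ :=
    abs_sub_dyadicCenter_le_of_mem_dyadicCube hx i
  have := abs_sub_le (y i) (x i) (((z i : ℝ) + 1 / 2) * (2 : ℝ) ^ (-k))
  linarith

theorem le_diam_dilatedCube {n : ℕ} (hn : n ≠ 0) (k : ℤ) (z : Fin n → ℤ) :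
    (2 : ℝ) ^ (-k) ≤ diam (dilatedCube n 3 k z) := by
  have hk : (0 : ℝ) < 2 ^ (-k) := by positivity
  have hbdd : Bornology.IsBounded (dilatedCube n 3 k z) :=
    isBounded_closedBall.subset fun x hx =>
      mem_closedBall.2 (dist_dyadicCenter_le_of_mem_dilatedCube hx)
  let i₀ : Fin n := ⟨0, Nat.pos_of_ne_zero hn⟩
  set e : EuclideanSpace ℝ (Fin n) := EuclideanSpace.single i₀ ((2 : ℝ) ^ (-k))
  have h1 : dyadicCenter n k z ∈ dilatedCube n 3 k z := fun i => by
    simp only [dyadicCenter, sub_self, abs_zero]; positivity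
  have h2 : dyadicCenter n k z + e ∈ dilatedCube n 3 k z := fun i => by
    have : |e i| ≤ (2 : ℝ) ^ (-k) := by
      refine (PiLp.norm_apply_le e i).trans ?_
      rw [PiLp.norm_single, Real.norm_eq_abs, abs_of_pos hk]
    simp only [dyadicCenter, PiLp.add_apply, add_sub_cancel_left]
    linarith
  have := dist_le_diam_of_mem hbdd h2 h1
  rwa [dist_self_add_left, PiLp.norm_single, Real.norm_eq_abs, abs_of_pos hk] at this

theorem measurableSet_dilatedCube (n : ℕ) (lam : ℝ) (k : ℤ) (z : Fin n → ℤ) :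
    MeasurableSet (dilatedCube n lam k z) := by
  simp only [dilatedCube, ofPred_forall]
  exact MeasurableSet.iInter fun i => measurableSet_le (by fun_prop) measurable_const

theorem measurableSet_dyadicCube (n : ℕ) (k : ℤ) (z : Fin n → ℤ) :
    MeasurableSet (dyadicCube n k z) := by
  simp only [dyadicCube, ofPred_forall, ofPred_and]
  exact MeasurableSet.iInter fun i => (measurableSet_le measurable_const (by fun_prop)).inter
    (measurableSet_le (by fun_prop) measurable_const)

theorem ofReal_dist_le_hausdorffMeasure {X : Type*} [MetricSpace X] [MeasurableSpace X]
    [BorelSpace X] {Γ : Set X} (hΓ : IsPreconnected Γ) {x y : X} (hx : x ∈ Γ) (hy : y ∈ Γ) :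
    ENNReal.ofReal (dist x y) ≤ μH[1] Γ := by
  have h1 : Icc 0 (dist x y) ⊆ dist x '' Γ := by
    have := hΓ.intermediate_value hx hy (f := dist x) (by fun_prop)
    rwa [dist_self] at this
  calc ENNReal.ofReal (dist x y) = volume (Icc 0 (dist x y)) := by simp
    _ ≤ volume (dist x '' Γ) := measure_mono h1
    _ ≤ μH[1] Γ := by
        rw [← hausdorffMeasure_real]
        simpa using (LipschitzWith.dist_right x).hausdorffMeasure_image_le zero_le_one Γ

theorem ofReal_diam_le_hausdorffMeasure {X : Type*} [MetricSpace X] [MeasurableSpace X]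
    [BorelSpace X] {Γ : Set X} (hΓ : IsPreconnected Γ) :
    ENNReal.ofReal (diam Γ) ≤ μH[1] Γ := by
  by_cases h : μH[1] Γ = ⊤
  · simp [h]
  refine ENNReal.ofReal_le_of_le_toReal (diam_le_of_forall_dist_le ENNReal.toReal_nonneg ?_)
  intro x hx y hy
  exact (ENNReal.ofReal_le_iff_le_toReal h).1 (ofReal_dist_le_hausdorffMeasure hΓ hx hy)

/-- A beta number estimate: near a curve `Γ`, the `L²` distance of `ν` from a line is controlled by
the distance of `ν` from `Γ` and the distance `H` of `Γ` from the line. -/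
theorem beta2Sq_mul_ofReal_diam_le {n : ℕ} (hn : n ≠ 0) {ν : Measure (EuclideanSpace ℝ (Fin n))}
    [IsFiniteMeasure ν] {Γ L : Set (EuclideanSpace ℝ (Fin n))} (hΓ : IsCompact Γ) (hL : IsLine L)
    {k : ℤ} {z : Fin n → ℤ} (hQ : (Γ ∩ dyadicCube n k z).Nonempty) {c : ℝ} (hc : 0 < c)
    (hν : ENNReal.ofReal (c * (2 : ℝ) ^ (-k)) ≤ ν (dilatedCube n 3 k z)) {H : ℝ≥0∞}
    (hH : ∀ y ∈ Γ, dist y (dyadicCenter n k z) ≤ 6 * n * (2 : ℝ) ^ (-k) →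
      ENNReal.ofReal (infDist y L ^ 2) ≤ H) :
    beta2Sq ν (dilatedCube n 3 k z) * ENNReal.ofReal (diam (dyadicCube n k z)) ≤
      ENNReal.ofReal (2 * n / c) *
          ∫⁻ x in dilatedCube n 3 k z, ENNReal.ofReal ((infDist x Γ * 2 ^ k) ^ 2) ∂ν +
        ENNReal.ofReal (2 * n * 2 ^ k) * H := by
  obtain ⟨x₀, hx₀, hx₀Q⟩ := hQ
  set Q₃ := dilatedCube n 3 k z with hQ₃
  set s : ℝ := (2 : ℝ) ^ (-k) with hs
  have hspos : 0 < s := by positivity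
  have hks : (2 : ℝ) ^ k = s⁻¹ := by rw [hs, zpow_neg, inv_inv]
  have hν0 : ν Q₃ ≠ 0 := fun h => by
    rw [h, nonpos_iff_eq_zero, ENNReal.ofReal_eq_zero] at hν
    exact absurd hν (not_le.2 (by positivity))
  have hpt : ∀ x ∈ Q₃, ENNReal.ofReal ((infDist x L / diam Q₃) ^ 2) ≤
      ENNReal.ofReal 2 * ENNReal.ofReal ((infDist x Γ * 2 ^ k) ^ 2) +
        ENNReal.ofReal (2 * (2 ^ k) ^ 2) * H := by
    intro x hx
    obtain ⟨y, hy, hxy⟩ := hΓ.exists_infDist_eq_dist ⟨x₀, hx₀⟩ x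
    have hxc := dist_dyadicCenter_le_of_mem_dilatedCube hx
    have hyc : dist y (dyadicCenter n k z) ≤ 6 * n * s := by
      have h1 : infDist x Γ ≤ dist x x₀ := infDist_le_dist_of_mem hx₀
      have h2 := dist_dyadicCenter_le_of_mem_dyadicCube hx₀Q
      have h3 := dist_triangle_right x x₀ (dyadicCenter n k z)
      have h4 := dist_triangle_left y (dyadicCenter n k z) x
      have : 0 ≤ n * s := by positivity
      linarith
    have h1 : infDist x L ≤ infDist y L + infDist x Γ := by
      rw [hxy]; exact infDist_le_infDist_add_dist
    have h2 : infDist x L / diam Q₃ ≤ (infDist x Γ + infDist y L) * 2 ^ k := by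
      rw [hks, ← div_eq_mul_inv, add_comm]
      have := le_diam_dilatedCube hn k z
      have h0 : 0 ≤ infDist x L := infDist_nonneg
      exact div_le_div₀ (h0.trans h1) h1 hspos this
    have h3 : (infDist x L / diam Q₃) ^ 2 ≤
        2 * (infDist x Γ * 2 ^ k) ^ 2 + 2 * (2 ^ k) ^ 2 * infDist y L ^ 2 := by
      have h0 : 0 ≤ infDist x L / diam Q₃ := div_nonneg infDist_nonneg diam_nonneg
      calc (infDist x L / diam Q₃) ^ 2 ≤ ((infDist x Γ + infDist y L) * 2 ^ k) ^ 2 := by gcongr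
        _ ≤ _ := by nlinarith [sq_nonneg ((infDist x Γ - infDist y L) * 2 ^ k)]
    calc ENNReal.ofReal ((infDist x L / diam Q₃) ^ 2)
        ≤ ENNReal.ofReal (2 * (infDist x Γ * 2 ^ k) ^ 2 + 2 * (2 ^ k) ^ 2 * infDist y L ^ 2) :=
          ENNReal.ofReal_le_ofReal h3
      _ = ENNReal.ofReal 2 * ENNReal.ofReal ((infDist x Γ * 2 ^ k) ^ 2) +
            ENNReal.ofReal (2 * (2 ^ k) ^ 2) * ENNReal.ofReal (infDist y L ^ 2) := by
          rw [ENNReal.ofReal_add (by positivity) (by positivity), ENNReal.ofReal_mul zero_le_two,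
            ENNReal.ofReal_mul (by positivity)]
      _ ≤ _ := by gcongr; exact hH y hy hyc
  set I := ∫⁻ x in Q₃, ENNReal.ofReal ((infDist x Γ * 2 ^ k) ^ 2) ∂ν with hI
  have hβ : beta2Sq ν Q₃ ≤
      ENNReal.ofReal (2 / (c * s)) * I + ENNReal.ofReal (2 * (2 ^ k) ^ 2) * H :=
    calc beta2Sq ν Q₃
        ≤ (∫⁻ x in Q₃, ENNReal.ofReal ((infDist x L / diam Q₃) ^ 2) ∂ν) / ν Q₃ :=
          iInf₂_le L hL
      _ ≤ (∫⁻ x in Q₃, (ENNReal.ofReal 2 * ENNReal.ofReal ((infDist x Γ * 2 ^ k) ^ 2) +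
            ENNReal.ofReal (2 * (2 ^ k) ^ 2) * H) ∂ν) / ν Q₃ := by
          gcongr ?_ / _
          exact setLIntegral_mono' (measurableSet_dilatedCube n 3 k z) hpt
      _ = ENNReal.ofReal 2 * I / ν Q₃ + ENNReal.ofReal (2 * (2 ^ k) ^ 2) * H := by
          rw [lintegral_add_right _ measurable_const, setLIntegral_const,
            lintegral_const_mul' _ _ ENNReal.ofReal_ne_top, ENNReal.add_div,
            ENNReal.mul_div_cancel_right hν0 (measure_ne_top ν Q₃)]
      _ ≤ _ := by
          gcongr
          calc ENNReal.ofReal 2 * I / ν Q₃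
              ≤ ENNReal.ofReal 2 * I / ENNReal.ofReal (c * s) := by gcongr
            _ = _ := by
              rw [ENNReal.ofReal_div_of_pos (by positivity), ENNReal.mul_div_right_comm]
  calc beta2Sq ν Q₃ * ENNReal.ofReal (diam (dyadicCube n k z))
      ≤ (ENNReal.ofReal (2 / (c * s)) * I + ENNReal.ofReal (2 * (2 ^ k) ^ 2) * H) *
          ENNReal.ofReal (n * s) := by
        gcongr
        exact diam_dyadicCube_le n k z
    _ = ENNReal.ofReal (2 / (c * s) * (n * s)) * I +
          ENNReal.ofReal (2 * (2 ^ k) ^ 2 * (n * s)) * H := by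
        rw [ENNReal.ofReal_mul (p := 2 / (c * s)) (by positivity),
          ENNReal.ofReal_mul (p := 2 * (2 ^ k) ^ 2) (by positivity)]
        ring
    _ = _ := by
        have h1 : 2 / (c * s) * (n * s) = 2 * n / c := by field_simp
        have h2 : 2 * (2 ^ k) ^ 2 * (n * s) = 2 * n * 2 ^ k := by rw [hks]; field_simp
        rw [h1, h2]

/-- Bounds for the sum of the squared beta numbers of the cubes that meet `E` carry over to the
integral of the Jones function over `E`. -/
theorem lintegral_jones2Tilde_le_of_forall_sum_le {n : ℕ} {ν : Measure (EuclideanSpace ℝ (Fin n))}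
    {r : ℝ} {E : Set (EuclideanSpace ℝ (Fin n))} {B : ℝ≥0∞}
    (hB : ∀ F : Finset (ℤ × (Fin n → ℤ)),
      (∀ Q ∈ F, (2 : ℝ) ^ (-Q.1) ≤ r ∧ (E ∩ dyadicCube n Q.1 Q.2).Nonempty) →
      ∑ Q ∈ F, beta2Sq ν (dilatedCube n 3 Q.1 Q.2) *
        ENNReal.ofReal (diam (dyadicCube n Q.1 Q.2)) ≤ B) :
    ∫⁻ x in E, jones2Tilde ν r x ∂ν ≤ B := by
  classical
  set c : ℤ × (Fin n → ℤ) → ℝ≥0∞ := fun Q => if (2 : ℝ) ^ (-Q.1) ≤ r then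
    (if ν (dyadicCube n Q.1 Q.2) = 0 then 0 else beta2Sq ν (dilatedCube n 3 Q.1 Q.2) *
      ENNReal.ofReal (diam (dyadicCube n Q.1 Q.2)) / ν (dyadicCube n Q.1 Q.2)) else 0 with hc
  have h1 : ∀ x, jones2Tilde ν r x =
      ∑' Q : ℤ × (Fin n → ℤ), (dyadicCube n Q.1 Q.2).indicator (fun _ => c Q) x := by
    intro x
    rw [jones2Tilde, ENNReal.tsum_prod']
    refine tsum_congr fun k => tsum_congr fun z => ?_
    simp only [hc, indicator_apply]
    split_ifs <;> first | rfl | tauto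
  have h2 : ∀ Q : ℤ × (Fin n → ℤ),
      ∫⁻ x in E, (dyadicCube n Q.1 Q.2).indicator (fun _ => c Q) x ∂ν ≤
        if (2 : ℝ) ^ (-Q.1) ≤ r ∧ (E ∩ dyadicCube n Q.1 Q.2).Nonempty then
          beta2Sq ν (dilatedCube n 3 Q.1 Q.2) * ENNReal.ofReal (diam (dyadicCube n Q.1 Q.2))
        else 0 := by
    intro Q
    have hQ := measurableSet_dyadicCube n Q.1 Q.2
    rw [lintegral_indicator_const hQ, Measure.restrict_apply hQ, inter_comm]
    split_ifs with h
    · simp only [hc, if_pos h.1]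
      split_ifs with h0
      · simp
      · refine (mul_le_mul_right (measure_mono inter_subset_right) _).trans ?_
        rw [mul_comm]
        exact ENNReal.mul_div_le
    · by_cases hr : (2 : ℝ) ^ (-Q.1) ≤ r
      · rw [not_nonempty_iff_eq_empty.1 fun hE => h ⟨hr, hE⟩, measure_empty, mul_zero]
      · simp only [hc, if_neg hr, zero_mul, le_refl]
  have h3 : ∀ Q : ℤ × (Fin n → ℤ), AEMeasurable ((dyadicCube n Q.1 Q.2).indicator fun _ => c Q)
      (ν.restrict E) := fun Q =>
    (measurable_const.indicator (measurableSet_dyadicCube n Q.1 Q.2)).aemeasurable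
  rw [lintegral_congr h1, lintegral_tsum h3, ENNReal.tsum_eq_iSup_sum]
  refine iSup_le fun F => ?_
  calc ∑ Q ∈ F, ∫⁻ x in E, (dyadicCube n Q.1 Q.2).indicator (fun _ => c Q) x ∂ν
      ≤ ∑ Q ∈ F, if (2 : ℝ) ^ (-Q.1) ≤ r ∧ (E ∩ dyadicCube n Q.1 Q.2).Nonempty then
          beta2Sq ν (dilatedCube n 3 Q.1 Q.2) * ENNReal.ofReal (diam (dyadicCube n Q.1 Q.2))
        else 0 := Finset.sum_le_sum fun Q _ => h2 Q
    _ ≤ B := by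
        rw [← Finset.sum_filter]
        exact hB _ fun Q hQ => (Finset.mem_filter.1 hQ).2

/-- The contribution of the mass of `ν` away from `Γ` to the beta numbers. -/
theorem exists_sum_lintegral_infDist_le (n : ℕ) :
    ∃ C : ℝ≥0∞, C ≠ ⊤ ∧ ∀ (ν : Measure (EuclideanSpace ℝ (Fin n)))
      (Γ : Set (EuclideanSpace ℝ (Fin n))), IsClosed Γ → ∀ F : Finset (ℤ × (Fin n → ℤ)),
      (∀ Q ∈ F, (Γ ∩ dyadicCube n Q.1 Q.2).Nonempty) →
      ∑ Q ∈ F, ∫⁻ x in dilatedCube n 3 Q.1 Q.2, ENNReal.ofReal ((infDist x Γ * 2 ^ Q.1) ^ 2) ∂ν ≤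
        C * ν Γᶜ := by
  classical
  obtain ⟨C, hC, hsum⟩ := sum_ofReal_mul_two_zpow_le n (2 * n) (3 * n)
  refine ⟨ENNReal.ofReal (3 * n) * C, ENNReal.mul_ne_top ENNReal.ofReal_ne_top hC,
    fun ν Γ hΓ F hF => ?_⟩
  have hm : ∀ Q : ℤ × (Fin n → ℤ), Measurable fun x : EuclideanSpace ℝ (Fin n) =>
      ENNReal.ofReal ((infDist x Γ * (2 : ℝ) ^ Q.1) ^ 2) := fun Q =>
    ((measurable_infDist.mul_const _).pow_const 2).ennreal_ofReal
  have hpt : ∀ x, ∑ Q ∈ F, (dilatedCube n 3 Q.1 Q.2).indicator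
      (fun x => ENNReal.ofReal ((infDist x Γ * (2 : ℝ) ^ Q.1) ^ 2)) x ≤
        Γᶜ.indicator (fun _ => ENNReal.ofReal (3 * n) * C) x := by
    intro x
    by_cases hx : x ∈ Γ
    · refine (Finset.sum_eq_zero fun Q _ => ?_).trans_le zero_le
      simp [indicator_apply, infDist_zero_of_mem hx]
    rw [indicator_of_mem (mem_compl hx)]
    have hd : 0 ≤ infDist x Γ := infDist_nonneg
    have hQd : ∀ Q ∈ F.filter fun Q => x ∈ dilatedCube n 3 Q.1 Q.2,
        infDist x Γ ≤ 3 * n * (2 : ℝ) ^ (-Q.1) ∧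
          dist x (dyadicCenter n Q.1 Q.2) ≤ 2 * n * (2 : ℝ) ^ (-Q.1) := by
      intro Q hQ
      obtain ⟨hQF, hxQ⟩ := Finset.mem_filter.1 hQ
      obtain ⟨y, hy, hyQ⟩ := hF Q hQF
      have h1 := dist_dyadicCenter_le_of_mem_dilatedCube hxQ
      have h2 := dist_dyadicCenter_le_of_mem_dyadicCube hyQ
      have h3 := dist_triangle_right x y (dyadicCenter n Q.1 Q.2)
      exact ⟨(infDist_le_dist_of_mem hy).trans (by linarith), h1⟩
    calc ∑ Q ∈ F, (dilatedCube n 3 Q.1 Q.2).indicator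
          (fun x => ENNReal.ofReal ((infDist x Γ * (2 : ℝ) ^ Q.1) ^ 2)) x
        = ∑ Q ∈ F.filter fun Q => x ∈ dilatedCube n 3 Q.1 Q.2,
            ENNReal.ofReal ((infDist x Γ * (2 : ℝ) ^ Q.1) ^ 2) := by
          simp only [indicator_apply, Finset.sum_filter]
      _ ≤ ∑ Q ∈ F.filter fun Q => x ∈ dilatedCube n 3 Q.1 Q.2,
            ENNReal.ofReal (3 * n) * ENNReal.ofReal (infDist x Γ * 2 ^ Q.1) := by
          refine Finset.sum_le_sum fun Q hQ => ?_
          have h := (hQd Q hQ).1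
          rw [← ENNReal.ofReal_mul (by positivity), sq]
          refine ENNReal.ofReal_le_ofReal ?_
          refine mul_le_mul_of_nonneg_right ?_ (by positivity)
          rwa [zpow_neg, ← div_eq_mul_inv, le_div_iff₀ (by positivity)] at h
      _ ≤ ENNReal.ofReal (3 * n) * C := by
          rw [← Finset.mul_sum]
          gcongr
          exact hsum x _ hd _ hQd
  calc ∑ Q ∈ F, ∫⁻ x in dilatedCube n 3 Q.1 Q.2, ENNReal.ofReal ((infDist x Γ * 2 ^ Q.1) ^ 2) ∂ν
      = ∫⁻ x, ∑ Q ∈ F, (dilatedCube n 3 Q.1 Q.2).indicator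
          (fun x => ENNReal.ofReal ((infDist x Γ * (2 : ℝ) ^ Q.1) ^ 2)) x ∂ν := by
        rw [lintegral_finsetSum _ fun Q _ =>
          (hm Q).indicator (measurableSet_dilatedCube n 3 Q.1 Q.2)]
        simp only [lintegral_indicator (measurableSet_dilatedCube n 3 _ _)]
    _ ≤ ∫⁻ x, Γᶜ.indicator (fun _ => ENNReal.ofReal (3 * n) * C) x ∂ν := lintegral_mono hpt
    _ = _ := lintegral_indicator_const hΓ.measurableSet.compl _

theorem exists_le_dist_of_lt_diam {X : Type*} [PseudoMetricSpace X] {Γ : Set X} {r : ℝ}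
    (hr : 0 ≤ r) (h : 2 * r < diam Γ) (x : X) : ∃ y ∈ Γ, r ≤ dist x y := by
  by_contra! hx
  refine h.not_ge (diam_le_of_forall_dist_le (by positivity) fun y hy z hz => ?_)
  have := dist_triangle_left y z x
  linarith [hx y hy, hx z hz]

/-- Let `n ≥ 2` and `c_E > 0`. There is a constant `C` depending only on
`n` and `c_E` such that for every finite Borel measure `ν` on `ℝⁿ`, every rectifiable curve
`Γ`, every Borel set `E ⊆ Γ` and every `r₀ > 0` with `ν(B(x,r)) ≥ c_E·r` for all `x ∈ E`
and `0 < r ≤ r₀`, one has `∫_E J̃₂(ν,r₀,x) dν(x) ≤ C (H¹(Γ) + ν(ℝⁿ \ Γ))`. -/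
theorem lintegral_jones2Tilde_le (n : ℕ) (hn : 2 ≤ n) (c_E : ℝ) (hc : 0 < c_E) :
    ∃ C : ℝ≥0∞, C ≠ ⊤ ∧
      ∀ (ν : Measure (EuclideanSpace ℝ (Fin n))), IsFiniteMeasure ν →
      ∀ (Γ E : Set (EuclideanSpace ℝ (Fin n))), IsRectifiableCurve Γ →
        MeasurableSet E → E ⊆ Γ →
      ∀ r₀ : ℝ, 0 < r₀ →
        (∀ x ∈ E, ∀ r : ℝ, 0 < r → r ≤ r₀ →
          ENNReal.ofReal (c_E * r) ≤ ν (Metric.closedBall x r)) →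
        ∫⁻ x in E, jones2Tilde ν r₀ x ∂ν ≤ C * (μH[1] Γ + ν (Set.univ \ Γ)) := by
  classical
  have hn0 : n ≠ 0 := by omega
  obtain ⟨C₁, hC₁, hline⟩ := exists_isLine_infDist_sq_le n (R := 6 * n) (by positivity)
  obtain ⟨C₂, hC₂, hcross⟩ := sum_hyperplaneMeasure_crossings_le n (6 * n + 11)
  obtain ⟨C₃, hC₃, hoff⟩ := exists_sum_lintegral_infDist_le n
  obtain ⟨C₄, hC₄, hgeom⟩ := sum_ofReal_mul_two_zpow_le n (20 + n) 20
  refine ⟨ENNReal.ofReal (2 * n / c_E) * C₃ + ENNReal.ofReal (2 * n * C₁) * C₂ +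
    ENNReal.ofReal (2 * n) * C₄, by finiteness, ?_⟩
  rintro ν hν _ E ⟨f, a, b, K, hf, rfl⟩ - hEΓ r₀ - hdens
  set Γ := f '' Icc a b with hΓ
  have hcomp : IsCompact Γ := isCompact_Icc.image_of_continuousOn hf.continuousOn
  have hconn : IsPreconnected Γ := isPreconnected_Icc.image f hf.continuousOn
  have hdiam : ENNReal.ofReal (diam Γ) ≤ μH[1] Γ := ofReal_diam_le_hausdorffMeasure hconn
  refine lintegral_jones2Tilde_le_of_forall_sum_le fun F hF => ?_
  have hΓF : ∀ Q ∈ F, (Γ ∩ dyadicCube n Q.1 Q.2).Nonempty := fun Q hQ =>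
    (hF Q hQ).2.mono (inter_subset_inter_left _ hEΓ)
  set I : ℤ × (Fin n → ℤ) → ℝ≥0∞ := fun Q =>
    ∫⁻ x in dilatedCube n 3 Q.1 Q.2, ENNReal.ofReal ((infDist x Γ * 2 ^ Q.1) ^ 2) ∂ν with hI
  set m : ℤ × (Fin n → ℤ) → ℝ≥0∞ := fun Q =>
    hyperplaneMeasure n (crossings Γ (dyadicCenter n Q.1 Q.2)
      ((6 * n + 11) * (2 : ℝ) ^ (-Q.1)) ((2 : ℝ) ^ (-Q.1))) with hm
  set D : ℤ × (Fin n → ℤ) → ℝ≥0∞ := fun Q =>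
    if diam Γ ≤ 20 * (2 : ℝ) ^ (-Q.1) then ENNReal.ofReal (diam Γ * 2 ^ Q.1) else 0 with hD
  have hterm : ∀ Q ∈ F, beta2Sq ν (dilatedCube n 3 Q.1 Q.2) *
      ENNReal.ofReal (diam (dyadicCube n Q.1 Q.2)) ≤
        ENNReal.ofReal (2 * n / c_E) * I Q + ENNReal.ofReal (2 * n * C₁) * m Q +
          ENNReal.ofReal (2 * n) * ENNReal.ofReal (diam Γ) * D Q := by
    rintro ⟨k, z⟩ hQ
    obtain ⟨hk, x, hxE, hxQ⟩ := hF _ hQ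
    have hspos : (0 : ℝ) < 2 ^ (-k) := by positivity
    have hνQ : ENNReal.ofReal (c_E * (2 : ℝ) ^ (-k)) ≤ ν (dilatedCube n 3 k z) :=
      (hdens x hxE _ hspos hk).trans (measure_mono (closedBall_subset_dilatedCube hxQ))
    by_cases hbig : diam Γ ≤ 20 * (2 : ℝ) ^ (-k)
    · let v : EuclideanSpace ℝ (Fin n) := EuclideanSpace.single ⟨0, by omega⟩ 1
      have hv : v ≠ 0 := by
        rw [← norm_ne_zero_iff, PiLp.norm_single, norm_one]
        exact one_ne_zero
      have hL : IsLine {y | ∃ t : ℝ, y = x + t • v} := ⟨x, v, hv, rfl⟩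
      refine (beta2Sq_mul_ofReal_diam_le hn0 hcomp hL (hΓF _ hQ) hc hνQ
        (H := ENNReal.ofReal (diam Γ ^ 2)) fun y hy _ => ?_).trans ?_
      · have hxL : x ∈ {y | ∃ t : ℝ, y = x + t • v} := ⟨0, by simp⟩
        have : infDist y {y | ∃ t : ℝ, y = x + t • v} ≤ diam Γ :=
          (infDist_le_dist_of_mem hxL).trans
            (dist_le_diam_of_mem hcomp.isBounded hy (hEΓ hxE))
        gcongr
        exact infDist_nonneg
      · have : ENNReal.ofReal (2 * n * 2 ^ k) * ENNReal.ofReal (diam Γ ^ 2) =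
            ENNReal.ofReal (2 * n) * ENNReal.ofReal (diam Γ) * D (k, z) := by
          have hd : 0 ≤ diam Γ := diam_nonneg
          simp only [hD, if_pos hbig]
          rw [← ENNReal.ofReal_mul (by positivity), ← ENNReal.ofReal_mul (by positivity),
            ← ENNReal.ofReal_mul (by positivity)]
          congr 1
          ring
        rw [this]
        gcongr
        exact le_self_add
    · obtain ⟨L, hL, hLH⟩ := hline f a b hf.continuousOn _ hspos
        (fun x _ => exists_le_dist_of_lt_diam (by positivity) (by linarith) x)
        (dyadicCenter n k z) x (hEΓ hxE) (by
          have := dist_dyadicCenter_le_of_mem_dyadicCube hxQ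
          have h0 : 0 ≤ n * (2 : ℝ) ^ (-k) := by positivity
          linarith)
      refine (beta2Sq_mul_ofReal_diam_le hn0 hcomp hL (hΓF _ hQ) hc hνQ hLH).trans ?_
      have : ENNReal.ofReal (2 * n * 2 ^ k) * (ENNReal.ofReal (C₁ * (2 : ℝ) ^ (-k)) * m (k, z)) =
          ENNReal.ofReal (2 * n * C₁) * m (k, z) := by
        rw [← mul_assoc, ← ENNReal.ofReal_mul (by positivity)]
        congr 2
        rw [zpow_neg]
        field_simp
      rw [this]
      exact le_self_add
  have hDsum : ∑ Q ∈ F, D Q ≤ C₄ := by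
    rcases F.eq_empty_or_nonempty with rfl | ⟨Q₀, hQ₀⟩
    · simp
    obtain ⟨x, hx, -⟩ := hΓF Q₀ hQ₀
    rw [← Finset.sum_filter]
    refine hgeom x (diam Γ) diam_nonneg _ fun Q hQ => ?_
    obtain ⟨hQF, hbig⟩ := Finset.mem_filter.1 hQ
    obtain ⟨y, hy, hyQ⟩ := hΓF Q hQF
    have h1 := dist_dyadicCenter_le_of_mem_dyadicCube hyQ
    have h2 := dist_le_diam_of_mem hcomp.isBounded hx hy
    have h3 := dist_triangle x y (dyadicCenter n Q.1 Q.2)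
    exact ⟨hbig, by linarith⟩
  have hcompl : ν (Set.univ \ Γ) = ν Γᶜ := by rw [compl_eq_univ_sdiff]
  calc ∑ Q ∈ F, beta2Sq ν (dilatedCube n 3 Q.1 Q.2) * ENNReal.ofReal (diam (dyadicCube n Q.1 Q.2))
      ≤ ∑ Q ∈ F, (ENNReal.ofReal (2 * n / c_E) * I Q + ENNReal.ofReal (2 * n * C₁) * m Q +
          ENNReal.ofReal (2 * n) * ENNReal.ofReal (diam Γ) * D Q) := Finset.sum_le_sum hterm
    _ = ENNReal.ofReal (2 * n / c_E) * ∑ Q ∈ F, I Q + ENNReal.ofReal (2 * n * C₁) * ∑ Q ∈ F, m Q +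
          ENNReal.ofReal (2 * n) * ENNReal.ofReal (diam Γ) * ∑ Q ∈ F, D Q := by
        simp only [Finset.sum_add_distrib, Finset.mul_sum]
    _ ≤ ENNReal.ofReal (2 * n / c_E) * (C₃ * ν Γᶜ) +
          ENNReal.ofReal (2 * n * C₁) * (C₂ * μH[1] Γ) +
            ENNReal.ofReal (2 * n) * μH[1] Γ * C₄ := by
        gcongr
        · exact hoff ν Γ hcomp.isClosed F hΓF
        · exact hcross Γ F
    _ = ENNReal.ofReal (2 * n / c_E) * C₃ * ν Γᶜ + (ENNReal.ofReal (2 * n * C₁) * C₂ +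
          ENNReal.ofReal (2 * n) * C₄) * μH[1] Γ := by ring
    _ ≤ (ENNReal.ofReal (2 * n / c_E) * C₃ + ENNReal.ofReal (2 * n * C₁) * C₂ +
          ENNReal.ofReal (2 * n) * C₄) * ν Γᶜ + (ENNReal.ofReal (2 * n / c_E) * C₃ +
            ENNReal.ofReal (2 * n * C₁) * C₂ + ENNReal.ofReal (2 * n) * C₄) * μH[1] Γ := by
        gcongr
        · rw [add_assoc]; exact le_self_add
        · exact le_add_self
    _ = _ := by rw [hcompl]; ring

end
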